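/- arXiv:2212.01604 — 2 statements merged into one kernel-verified Lean document; each statement's English description precedes it below -/
import Mathlib

section
/- Assume cov(M) = 𝔠, i.e., the real line is not the union of fewer than continuum many meager sets. Let X be a subsemigroup of a compact Hausdorff topological semigroup. Suppose that for every injective homomorphism h : X → Y into a topological semigroup Y that is either compact Hausdorff or Hausdorff 0-discrete, the image h[X] is closed in Y. Then X is polybounded. -/
open Cardinal Pointwise

universe u

namespace ZeroClosedPaper

/-- The value of the semigroup polynomial with coefficient list `a = [a₀, a₁, …, aₙ]`
(coefficients in `X¹ = WithOne X`) at the point `x`, i.e. `a₀xa₁x⋯xaₙ`,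
computed in the monoid `WithOne X`. Its degree (the number of occurrences of `x`)
is `a.length - 1`. -/
def polyVal {X : Type*} [Semigroup X] (a : List (WithOne X)) (x : X) : WithOne X :=
  match a with
  | [] => 1
  | a₀ :: rest => a₀ * (rest.map (fun ai => (x : WithOne X) * ai)).prod

/-- A subset `A` of a semigroup `X` is algebraic if
`A = {x ∈ X : a₀xa₁⋯xaₙ = b}` for some `n ≥ 1`, `b ∈ X` and `a₀,…,aₙ ∈ X¹`. -/
def IsAlgebraicSet {X : Type*} [Semigroup X] (A : Set X) : Prop :=
  ∃ (a : List (WithOne X)) (b : X), 2 ≤ a.length ∧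
    A = {x : X | polyVal a x = (b : WithOne X)}

/-- The polyboundedness number `cov(A_X)`: the smallest cardinality of a cover of `X`
by algebraic subsets of `X`. -/
noncomputable def covA (X : Type*) [Semigroup X] : Cardinal :=
  sInf {c : Cardinal | ∃ C : Set (Set X), (∀ A ∈ C, IsAlgebraicSet A) ∧
    ⋃₀ C = Set.univ ∧ Cardinal.mk ↥C = c}

/-- A subset `S` of a semigroup `X` is polybounded in `X` if it can be covered by
finitely many algebraic subsets of `X`. -/
def PolyboundedIn {X : Type*} [Semigroup X] (S : Set X) : Prop :=
  ∃ C : Set (Set X), C.Finite ∧ (∀ A ∈ C, IsAlgebraicSet A) ∧ S ⊆ ⋃₀ C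

/-- A semigroup is polybounded if it admits a finite cover by algebraic sets. -/
def Polybounded (X : Type*) [Semigroup X] : Prop :=
  PolyboundedIn (Set.univ : Set X)

/-- A semigroup `X` is polyfinite if there are `n ∈ ℕ` and a finite `F ⊆ X` such that
for all `x, y ∈ X` some semigroup polynomial `f` of degree `≤ n` has `f(x), f(y) ∈ F`. -/
def Polyfinite (X : Type*) [Semigroup X] : Prop :=
  ∃ (n : ℕ) (F : Set X), F.Finite ∧ ∀ x y : X, ∃ a : List (WithOne X),
    2 ≤ a.length ∧ a.length ≤ n + 1 ∧
    (∃ u ∈ F, polyVal a x = (u : WithOne X)) ∧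
    (∃ v ∈ F, polyVal a y = (v : WithOne X))

/-- A semigroup `X` is zero-closed if `X` is closed in its `0`-extension
`X⁰ = WithZero X` endowed with any Hausdorff semigroup topology. -/
def ZeroClosed (X : Type*) [Semigroup X] : Prop :=
  ∀ τ : TopologicalSpace (WithZero X),
    @T2Space (WithZero X) τ → @ContinuousMul (WithZero X) τ _ →
    @IsClosed (WithZero X) τ (Set.range ((↑) : X → WithZero X))

/-- `d` is a pseudometric. -/
def IsPseudometric {X : Type*} (d : X → X → ℝ) : Prop :=
  (∀ x, d x x = 0) ∧ (∀ x y, d x y = d y x) ∧ (∀ x y z, d x z ≤ d x y + d y z)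

/-- `d` is subinvariant: `d(axb, ayb) ≤ d(x,y)` for all `a, b ∈ X¹`
(equivalently, `d` is both left- and right-nonexpansive under translations). -/
def Subinvariant {X : Type*} [Semigroup X] (d : X → X → ℝ) : Prop :=
  (∀ a x y : X, d (a * x) (a * y) ≤ d x y) ∧
  (∀ b x y : X, d (x * b) (y * b) ≤ d x y)

/-- `d` is separable: some countable set is `d`-dense. -/
def SeparablePseudometric {X : Type*} (d : X → X → ℝ) : Prop :=
  ∃ C : Set X, C.Countable ∧ ∀ x : X, ∀ ε : ℝ, 0 < ε → ∃ c ∈ C, d x c < ε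

/-- `cov(M)`: the smallest cardinality of a cover of the real line by meager sets. -/
noncomputable def covMeager : Cardinal :=
  sInf {c : Cardinal | ∃ S : Set (Set ℝ), (∀ A ∈ S, IsMeagre A) ∧
    ⋃₀ S = Set.univ ∧ Cardinal.mk ↥S = c}

/-- `cov(N̄)`: the smallest cardinality of a cover of the real line by closed
Lebesgue-null sets. -/
noncomputable def covClosedNull : Cardinal :=
  sInf {c : Cardinal | ∃ S : Set (Set ℝ),
    (∀ A ∈ S, IsClosed A ∧ MeasureTheory.volume A = 0) ∧
    ⋃₀ S = Set.univ ∧ Cardinal.mk ↥S = c}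

/-- A topological space is power-Lindelöf if each finite power is Lindelöf. -/
def PowerLindelof (Y : Type*) [TopologicalSpace Y] : Prop :=
  ∀ n : ℕ, LindelofSpace (Fin n → Y)

/-- `I` is an ideal of the semigroup `X`. -/
def IsIdeal {X : Type*} [Semigroup X] (I : Set X) : Prop :=
  ∀ x ∈ I, ∀ a : X, x * a ∈ I ∧ a * x ∈ I

section

open Filter Topology

/-- Every homomorphic embedding of `X` into a Hausdorff `0`-discrete topological semigroup
has closed image. -/
def ZeroDiscretelyClosed (X : Type u) [Semigroup X] : Prop :=
  ∀ (Y : Type u) [Semigroup Y] [TopologicalSpace Y],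
    ∀ [ContinuousMul Y] [T2Space Y], ∀ z : Y,
    ¬ IsOpen ({z} : Set Y) → (∀ y : Y, y ≠ z → IsOpen ({y} : Set Y)) →
    (∀ y : Y, z * y = z ∧ y * z = z) →
    ∀ f : X →ₙ* Y, Function.Injective f → IsClosed (Set.range f)

theorem ZeroDiscretelyClosed.eq_bot {X : Type u} [Semigroup X] (hX : ZeroDiscretelyClosed X)
    (F : Filter X) (hF : ∀ x, {x}ᶜ ∈ F)
    (hmul : Tendsto (fun p : X × X => p.1 * p.2) (F ×ˢ F) F)
    (hl : ∀ a, Tendsto (fun x => a * x) F F) (hr : ∀ a, Tendsto (fun x => x * a) F F) :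
    F = ⊥ := by
  by_contra hne
  have : F.NeBot := ⟨hne⟩
  let τ : TopologicalSpace (WithZero X) :=
    nhdsAdjoint 0 (map ((↑) : X → WithZero X) F)
  have hn0 : 𝓝 (0 : WithZero X) = pure 0 ⊔ map ((↑) : X → WithZero X) F :=
    nhds_nhdsAdjoint_same _ _
  have hnx : ∀ x : X, 𝓝 (x : WithZero X) = pure (x : WithZero X) := fun x =>
    nhds_nhdsAdjoint_of_ne _ (WithZero.coe_ne_zero)
  have hopen : ∀ y : WithZero X, y ≠ 0 → IsOpen ({y} : Set (WithZero X)) := fun y hy =>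
    isOpen_singleton_nhdsAdjoint _ hy
  have hsep : ∀ x : X, ({(x : WithZero X)}ᶜ : Set (WithZero X)) ∈ 𝓝 (0 : WithZero X) := by
    intro x
    rw [hn0, mem_sup]
    refine ⟨by simp, ?_⟩
    rw [mem_map]
    filter_upwards [hF x] with y hy
    simpa using hy
  have hT2 : T2Space (WithZero X) := by
    refine t2Space_iff_disjoint_nhds.2 fun a b hab => ?_
    induction a with
    | zero =>
      induction b with
      | zero => exact absurd rfl hab
      | coe b =>
        rw [hnx b, ← principal_singleton, disjoint_principal_right]
        exact hsep b
    | coe a =>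
      induction b with
      | zero =>
        rw [hnx a, ← principal_singleton, disjoint_principal_left]
        exact hsep a
      | coe b =>
        rw [hnx a, hnx b, disjoint_pure_pure]
        exact hab
  have hzz : Tendsto (fun x : X => (x : WithZero X)) F (𝓝 0) := by
    rw [hn0]; exact (tendsto_map).mono_right le_sup_right
  have hCM : ContinuousMul (WithZero X) := by
    refine ⟨continuous_iff_continuousAt.2 ?_⟩
    rintro ⟨a, b⟩
    rw [ContinuousAt, nhds_prod_eq]
    induction a with
    | zero =>
      induction b with
      | zero =>
        simp only [mul_zero]
        conv_lhs => rw [hn0]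
        simp only [sup_prod, prod_sup, tendsto_sup, prod_pure, pure_prod, map_map, tendsto_map'_iff,
          prod_map_map_eq, tendsto_pure_left, Function.comp_def]
        refine ⟨⟨?_, ?_⟩, ?_, ?_⟩
        · intro s hs; simpa using mem_of_mem_nhds hs
        · exact tendsto_const_nhds
        · exact tendsto_const_nhds
        · have := hzz.comp hmul
          simpa only [Function.comp_def, WithZero.coe_mul] using this
      | coe b =>
        simp only [zero_mul]
        conv_lhs => rw [hn0, hnx]
        simp only [prod_pure, tendsto_map'_iff, tendsto_sup, Function.comp_def, tendsto_pure_left]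
        refine ⟨?_, ?_⟩
        · intro s hs; simpa using mem_of_mem_nhds hs
        · have := hzz.comp (hr b)
          simpa only [Function.comp_def, WithZero.coe_mul] using this
    | coe a =>
      induction b with
      | zero =>
        simp only [mul_zero]
        conv_lhs => rw [hn0, hnx]
        simp only [pure_prod, tendsto_map'_iff, tendsto_sup, Function.comp_def, tendsto_pure_left]
        refine ⟨?_, ?_⟩
        · intro s hs; simpa using mem_of_mem_nhds hs
        · have := hzz.comp (hl a)
          simpa only [Function.comp_def, WithZero.coe_mul] using this
      | coe b =>
        conv_lhs => rw [hnx, hnx]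
        rw [prod_pure_pure, tendsto_pure_left]
        intro s hs; exact mem_of_mem_nhds hs
  have hacc : ∀ s ∈ 𝓝 (0 : WithZero X), ∃ x : X, (x : WithZero X) ∈ s := fun s hs =>
    (hzz.eventually hs).exists
  have hcl := hX (WithZero X) 0
    (fun h => by
      obtain ⟨x, hx⟩ := hacc _ (h.mem_nhds rfl)
      exact WithZero.coe_ne_zero hx)
    hopen (fun y => ⟨zero_mul y, mul_zero y⟩)
    ⟨((↑) : X → WithZero X), fun a b => WithZero.coe_mul a b⟩ WithZero.coe_injective
  obtain ⟨x, hx⟩ := hacc _ (hcl.isOpen_compl.mem_nhds (x := 0) (by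
    rintro ⟨x, hx⟩
    exact WithZero.coe_ne_zero hx))
  exact hx ⟨x, rfl⟩

/-- A nonempty compact Hausdorff semigroup contains an idempotent `e` such that every element of
`eXe` has an inverse in `eXe`. -/
theorem exists_idempotent_forall_exists_inverse (X : Type*) [Semigroup X] [TopologicalSpace X]
    [CompactSpace X] [T2Space X] [ContinuousMul X] [Nonempty X] :
    ∃ e : X, e * e = e ∧ ∀ x, e * x = x → x * e = x →
      ∃ y, e * y = y ∧ y * e = y ∧ y * x = e ∧ x * y = e := by
  let S : Set (Set X) := {N | IsClosed N ∧ N.Nonempty ∧ ∀ a, ∀ m ∈ N, a * m ∈ N}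
  obtain ⟨L, hL⟩ : ∃ N, Minimal (· ∈ S) N := by
    refine zorn_superset _ fun c hcs hc => ?_
    refine ⟨⋂₀ c, ⟨isClosed_sInter fun t ht => (hcs ht).1, ?_, fun a m hm => ?_⟩, fun s hs =>
      Set.sInter_subset_of_mem hs⟩
    · obtain rfl | hcnemp := c.eq_empty_or_nonempty
      · rw [Set.sInter_empty]
        apply Set.univ_nonempty
      · rw [Set.sInter_eq_iInter]
        have := hcnemp.coe_sort
        exact IsCompact.nonempty_iInter_of_directed_nonempty_isCompact_isClosed
          ((↑) : c → Set X) (DirectedOn.directed_val (IsChain.directedOn hc.symm))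
          (fun i => (hcs i.prop).2.1) (fun i => (hcs i.prop).1.isCompact)
          (fun i => (hcs i.prop).1)
    · rw [Set.mem_sInter]
      exact fun t ht => (hcs ht).2.2 a m (Set.mem_sInter.mp hm t ht)
  obtain ⟨hLc, hLn, hLi⟩ := hL.prop
  obtain ⟨e, heL, hee⟩ := exists_idempotent_in_compact_subsemigroup
    (fun r : X => continuous_id.mul continuous_const) L hLn hLc.isCompact
    (fun x _ y hy => hLi x y hy)
  have key : ∀ y ∈ L, ∃ w, w * y = e := by
    intro y hy
    have : Set.range (· * y) = L := by
      apply hL.eq_of_subset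
      · refine ⟨(isCompact_range (continuous_id.mul continuous_const)).isClosed, ⟨_, y, rfl⟩, ?_⟩
        rintro a _ ⟨b, rfl⟩
        exact ⟨a * b, mul_assoc _ _ _⟩
      · rintro _ ⟨a, rfl⟩
        exact hLi a y hy
    rw [← this] at heL
    exact heL
  have left : ∀ x, e * x = x → x * e = x → ∃ y, e * y = y ∧ y * e = y ∧ y * x = e := by
    intro x h1 h2
    obtain ⟨w, hw⟩ := key x (h2 ▸ hLi x e heL)
    refine ⟨e * w * e, ?_, ?_, ?_⟩
    · rw [← mul_assoc, ← mul_assoc, hee]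
    · rw [mul_assoc, hee]
    · rw [mul_assoc, h1, mul_assoc, hw, hee]
  refine ⟨e, hee, fun x h1 h2 => ?_⟩
  obtain ⟨y, hy1, hy2, hy⟩ := left x h1 h2
  obtain ⟨w, hw1, hw2, hw⟩ := left y hy1 hy2
  refine ⟨y, hy1, hy2, hy, ?_⟩
  have : w = x := by
    calc w = w * (y * x) := by rw [hy, hw2]
      _ = x := by rw [← mul_assoc, hw, h1]
  rw [← this, hw]

section GenericPoint

variable {Z : Type*} [TopologicalSpace Z]

open Classical in
/-- The nested sequence of open sets read off the binary digits of `r`: after `j` zeros, the digit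
one replaces the current set by the `j`-th set of the sequence `V`, if that one is nonempty and its
closure lies in the current set. The second component counts the zeros. -/
noncomputable def digitState (V : ℕ → Set Z) : ℕ → ℝ → Set Z × ℕ
  | 0, _ => (Set.univ, 0)
  | k + 1, r =>
    if Even ⌊(2 : ℝ) ^ (k + 1) * r⌋ then
      ((digitState V k r).1, (digitState V k r).2 + 1)
    else
      (if (V (digitState V k r).2).Nonempty ∧
          closure (V (digitState V k r).2) ⊆ (digitState V k r).1 then
        V (digitState V k r).2 else (digitState V k r).1, 0)

theorem digitState_isOpen {V : ℕ → Set Z} (hV : ∀ n, IsOpen (V n)) (k : ℕ) (r : ℝ) :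
    IsOpen (digitState V k r).1 := by
  induction k with
  | zero => exact isOpen_univ
  | succ k ih =>
    rw [digitState]
    split_ifs
    · exact ih
    · exact hV _
    · exact ih

theorem digitState_nonempty [Nonempty Z] (V : ℕ → Set Z) (k : ℕ) (r : ℝ) :
    (digitState V k r).1.Nonempty := by
  induction k with
  | zero => exact Set.univ_nonempty
  | succ k ih =>
    rw [digitState]
    split_ifs with _ h
    · exact ih
    · exact h.1
    · exact ih

theorem digitState_antitone (V : ℕ → Set Z) (r : ℝ) :
    Antitone fun k => (digitState V k r).1 := by
  refine antitone_nat_of_succ_le fun k => ?_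
  rw [digitState]
  split_ifs with _ h
  · exact le_rfl
  · exact subset_closure.trans h.2
  · exact le_rfl

theorem floor_two_pow_eq {k : ℕ} {r : ℝ} {m : ℤ} {b : ℤ} (hb : b = 0 ∨ b = 1)
    (h : ⌊(2 : ℝ) ^ (k + 1) * r⌋ = 2 * m + b) : ⌊(2 : ℝ) ^ k * r⌋ = m := by
  rw [Int.floor_eq_iff] at h ⊢
  rw [pow_succ] at h
  push_cast at h
  rcases hb with rfl | rfl <;> push_cast at h <;> constructor <;> linarith

theorem digitState_congr (V : ℕ → Set Z) {k : ℕ} {r s : ℝ}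
    (h : ⌊(2 : ℝ) ^ k * r⌋ = ⌊(2 : ℝ) ^ k * s⌋) : digitState V k r = digitState V k s := by
  induction k with
  | zero => rfl
  | succ k ih =>
    have h' : ⌊(2 : ℝ) ^ k * r⌋ = ⌊(2 : ℝ) ^ k * s⌋ := by
      rcases Int.even_or_odd' ⌊(2 : ℝ) ^ (k + 1) * r⌋ with ⟨m, hm | hm⟩
      · rw [floor_two_pow_eq (Or.inl rfl) (hm.trans (add_zero _).symm),
          floor_two_pow_eq (Or.inl rfl) ((h.symm.trans hm).trans (add_zero _).symm)]
      · rw [floor_two_pow_eq (Or.inr rfl) hm, floor_two_pow_eq (Or.inr rfl) (h.symm.trans hm)]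
    rw [digitState, digitState, h, ih h']

theorem digitState_zeros (V : ℕ → Set Z) (k : ℕ) (m : ℤ) {r₀ : ℝ}
    (hr₀ : ⌊(2 : ℝ) ^ k * r₀⌋ = m) (t : ℕ) {r : ℝ}
    (hr : ⌊(2 : ℝ) ^ (k + t) * r⌋ = 2 ^ t * m) :
    ⌊(2 : ℝ) ^ k * r⌋ = m ∧
      digitState V (k + t) r = ((digitState V k r₀).1, (digitState V k r₀).2 + t) := by
  induction t with
  | zero =>
    simp only [add_zero, pow_zero, one_mul] at hr ⊢
    exact ⟨hr, digitState_congr V (hr.trans hr₀.symm)⟩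
  | succ t ih =>
    rw [← add_assoc] at hr ⊢
    have h2 : ⌊(2 : ℝ) ^ (k + t + 1) * r⌋ = 2 * (2 ^ t * m) + 0 := by rw [hr]; ring
    obtain ⟨h3, h4⟩ := ih (floor_two_pow_eq (Or.inl rfl) h2)
    refine ⟨h3, ?_⟩
    rw [digitState, if_pos, h4]
    · rfl
    · rw [h2, add_zero]; exact even_two_mul _

theorem exists_open_digitState_subset [Nonempty Z] [RegularSpace Z] {V : ℕ → Set Z}
    (hV : TopologicalSpace.IsTopologicalBasis (Set.range V)) {O : Set Z} (hO : IsOpen O)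
    (hOd : Dense O) {J : Set ℝ} (hJ : IsOpen J) (hJn : J.Nonempty) :
    ∃ I ⊆ J, IsOpen I ∧ I.Nonempty ∧ ∃ k, ∀ r ∈ I, closure (digitState V k r).1 ⊆ O := by
  obtain ⟨r₀, hr₀⟩ := hJn
  obtain ⟨ε, hε, hεJ⟩ := Metric.isOpen_iff.1 hJ r₀ hr₀
  obtain ⟨k, hk⟩ := exists_pow_lt_of_lt_one hε (show (1 / 2 : ℝ) < 1 by norm_num)
  set m := ⌊(2 : ℝ) ^ k * r₀⌋ with hm
  have hcell : ∀ r, ⌊(2 : ℝ) ^ k * r⌋ = m → r ∈ J := by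
    intro r hr
    apply hεJ
    rw [Metric.mem_ball, Real.dist_eq]
    refine lt_of_mul_lt_mul_left ?_ (pow_nonneg (zero_le_two : (0 : ℝ) ≤ 2) k)
    have h1 : |(2 : ℝ) ^ k * r - 2 ^ k * r₀| < 1 := Int.abs_sub_lt_one_of_floor_eq_floor hr
    rw [← mul_sub, abs_mul, abs_of_nonneg (by positivity : (0 : ℝ) ≤ 2 ^ k)] at h1
    refine h1.trans ?_
    have : (2 : ℝ) ^ k * (1 / 2) ^ k = 1 := by rw [← mul_pow]; norm_num
    rw [← this]
    gcongr
  have hVo : ∀ n, IsOpen (V n) := fun n => hV.isOpen ⟨n, rfl⟩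
  have hcellne : ∀ (n : ℕ) (l : ℤ), ⌊(2 : ℝ) ^ n * (l / 2 ^ n)⌋ = l := by
    intro n l
    rw [mul_div_cancel₀ _ (by positivity)]
    exact Int.floor_intCast l
  set r₁ : ℝ := ((2 * m + 1 : ℤ) : ℝ) / 2 ^ (k + 1)
  have hr₁ : ⌊(2 : ℝ) ^ (k + 1) * r₁⌋ = 2 * m + 1 := hcellne _ _
  have hcount : (digitState V (k + 1) r₁).2 = 0 := by
    rw [digitState, if_neg]
    rw [hr₁]
    simp
  set W := (digitState V (k + 1) r₁).1
  obtain ⟨x, hxW, hxO⟩ := hOd.inter_open_nonempty W (digitState_isOpen hVo _ _)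
    (digitState_nonempty V _ _)
  obtain ⟨_, ⟨j, rfl⟩, hxj, hj⟩ := hV.exists_closure_subset
    (((digitState_isOpen hVo (k + 1) r₁).inter hO).mem_nhds ⟨hxW, hxO⟩)
  set l : ℤ := 2 * (2 ^ j * (2 * m + 1)) + 1
  refine ⟨{r | 2 ^ (k + 1 + j + 1) * r ∈ Set.Ioo (l : ℝ) (l + 1)}, ?_, ?_, ?_, k + 1 + j + 1, ?_⟩
  · intro r hr
    have h1 : ⌊(2 : ℝ) ^ (k + 1 + j + 1) * r⌋ = l :=
      Int.floor_eq_iff.2 ⟨hr.1.le, hr.2⟩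
    have h2 := floor_two_pow_eq (Or.inr rfl) h1
    exact hcell r (floor_two_pow_eq (Or.inr rfl) (digitState_zeros V _ _ hr₁ j h2).1)
  · exact isOpen_Ioo.preimage (continuous_const.mul continuous_id)
  · refine ⟨(l + 1 / 2) / 2 ^ (k + 1 + j + 1), ?_⟩
    rw [Set.mem_ofPred_eq, mul_div_cancel₀ _ (by positivity)]
    constructor <;> linarith
  · intro r hr
    have h1 : ⌊(2 : ℝ) ^ (k + 1 + j + 1) * r⌋ = l :=
      Int.floor_eq_iff.2 ⟨hr.1.le, hr.2⟩
    have h2 := (digitState_zeros V _ _ hr₁ j (floor_two_pow_eq (Or.inr rfl) h1)).2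
    rw [hcount, zero_add] at h2
    have h3 : (digitState V (k + 1 + j + 1) r).1 = V j := by
      rw [digitState, if_neg, h2]
      · exact if_pos ⟨⟨x, hxj⟩, hj.trans Set.inter_subset_left⟩
      · rw [h1]
        simp [l]
    rw [h3]
    exact hj.trans Set.inter_subset_right

/-- Fewer than `cov(M)` closed sets with empty interior do not cover a nonempty compact regular
second countable space. -/
theorem exists_forall_notMem_of_lt_covMeager (Z : Type u) [TopologicalSpace Z] [CompactSpace Z]
    [RegularSpace Z] [SecondCountableTopology Z] [Nonempty Z] {ι : Type u} (N : ι → Set Z)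
    (hι : #ι < Cardinal.lift.{u} covMeager) (hN : ∀ i, IsClosed (N i))
    (hN' : ∀ i, interior (N i) = ∅) : ∃ z, ∀ i, z ∉ N i := by
  obtain ⟨B, hBc, -, hB⟩ := TopologicalSpace.exists_countable_basis Z
  have hBn : B.Nonempty := by
    obtain ⟨z⟩ := ‹Nonempty Z›
    obtain ⟨s, hs, -⟩ := hB.exists_subset_of_mem_open (Set.mem_univ z) isOpen_univ
    exact ⟨s, hs⟩
  obtain ⟨V, rfl⟩ := hBc.exists_eq_range hBn
  have hne : ∀ r : ℝ, (⋂ k, closure (digitState V k r).1).Nonempty := fun r =>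
    IsCompact.nonempty_iInter_of_directed_nonempty_isCompact_isClosed _
      (Antitone.directed_ge fun _ _ h => closure_mono (digitState_antitone V r h))
      (fun k => (digitState_nonempty V k r).closure) (fun _ => isClosed_closure.isCompact)
      (fun _ => isClosed_closure)
  choose p hp using hne
  by_contra! hcov
  have hmeag : ∀ i, IsMeagre (p ⁻¹' N i) := by
    intro i
    have hd : Dense (N i)ᶜ := interior_eq_empty_iff_dense_compl.1 (hN' i)
    let 𝒥 : Set (Set ℝ) := {I | IsOpen I ∧ ∃ k, ∀ r ∈ I, closure (digitState V k r).1 ⊆ (N i)ᶜ}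
    have hsub : ⋃₀ 𝒥 ⊆ (p ⁻¹' N i)ᶜ := by
      rintro r ⟨I, ⟨-, k, hk⟩, hr⟩
      exact hk r hr (Set.mem_iInter.1 (hp r) k)
    refine mem_of_superset (residual_of_dense_open (isOpen_sUnion fun I hI => hI.1) ?_) hsub
    refine dense_iff_inter_open.2 fun J hJ hJn => ?_
    obtain ⟨I, hIJ, hIo, ⟨r, hr⟩, hk⟩ :=
      exists_open_digitState_subset hB (hN i).isOpen_compl hd hJ hJn
    exact ⟨r, hIJ hr, I, ⟨hIo, hk⟩, hr⟩
  have hle : covMeager ≤ #(Set.range fun i => p ⁻¹' N i) := by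
    refine csInf_le' ⟨_, ?_, ?_, rfl⟩
    · rintro _ ⟨i, rfl⟩
      exact hmeag i
    · refine Set.eq_univ_of_forall fun r => ?_
      obtain ⟨i, hi⟩ := hcov (p r)
      exact ⟨_, ⟨i, rfl⟩, hi⟩
  have h1 := Cardinal.mk_range_le_lift (f := fun i => p ⁻¹' N i)
  rw [Cardinal.lift_id'.{0, u}] at h1
  exact absurd ((Cardinal.lift_le.{u}.2 hle).trans h1) (not_le.2 hι)

end GenericPoint

theorem mk_closure_lt_continuum {N : Type u} [Semigroup N] {S : Set N} (hS : #S < 𝔠) :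
    #(Subsemigroup.closure S) < 𝔠 := by
  let φ : FreeSemigroup S →ₙ* N := FreeSemigroup.lift (fun s : S => (s : N))
  have hle : Subsemigroup.closure S ≤ φ.srange := by
    rw [Subsemigroup.closure_le]
    intro s hs
    exact ⟨FreeSemigroup.of ⟨s, hs⟩, FreeSemigroup.lift_of _ _⟩
  have h1 : #(Subsemigroup.closure S) ≤ #(Set.range φ) :=
    Cardinal.mk_le_mk_of_subset fun x hx => hle hx
  have h2 : #(FreeSemigroup S) ≤ #(List S) := by
    refine Cardinal.mk_le_of_injective (f := fun w => w.head :: w.tail) fun v w h => ?_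
    obtain ⟨h, h'⟩ := List.cons.inj h
    exact FreeSemigroup.ext h h'
  exact (h1.trans (Cardinal.mk_range_le.trans (h2.trans (Cardinal.mk_list_le_max _)))).trans_lt
    (max_lt Cardinal.aleph0_lt_continuum hS)

/-- The functions given by the semigroup polynomials of positive degree with coefficients
in `S`. -/
inductive IsPolyFun {M : Type*} [Semigroup M] (S : Set M) : (M → M) → Prop
  | id : IsPolyFun S fun x => x
  | const_mul {s : M} {f : M → M} : s ∈ S → IsPolyFun S f → IsPolyFun S fun x => s * f x
  | mul_const {s : M} {f : M → M} : s ∈ S → IsPolyFun S f → IsPolyFun S fun x => f x * s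
  | mul {f g : M → M} : IsPolyFun S f → IsPolyFun S g → IsPolyFun S fun x => f x * g x

theorem IsPolyFun.mono {M : Type*} [Semigroup M] {S T : Set M} (h : S ⊆ T) {f : M → M}
    (hf : IsPolyFun S f) : IsPolyFun T f := by
  induction hf with
  | id => exact .id
  | const_mul hs _ ih => exact .const_mul (h hs) ih
  | mul_const hs _ ih => exact .mul_const (h hs) ih
  | mul _ _ ih ih' => exact .mul ih ih'

theorem IsPolyFun.apply_mem {M : Type*} [Semigroup M] {S : Subsemigroup M} {f : M → M}
    (hf : IsPolyFun (S : Set M) f) {x : M} (hx : x ∈ S) : f x ∈ S := by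
  induction hf with
  | id => exact hx
  | const_mul hs _ ih => exact S.mul_mem hs ih
  | mul_const hs _ ih => exact S.mul_mem ih hs
  | mul _ _ ih ih' => exact S.mul_mem ih ih'

theorem mk_isPolyFun_lt_continuum {M : Type u} [Semigroup M] {S : Set M} (hS : #S < 𝔠) :
    #{f | IsPolyFun S f} < 𝔠 := by
  let T : Set (M → M) := insert (fun x => x) (Function.const M '' S)
  have hT : #T < 𝔠 :=
    (Cardinal.mk_insert_le.trans (add_le_add_left Cardinal.mk_image_le 1)).trans_lt
      (Cardinal.add_lt_of_lt Cardinal.aleph0_le_continuum hS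
        (Cardinal.one_lt_aleph0.trans Cardinal.aleph0_lt_continuum))
  have hle : {f | IsPolyFun S f} ⊆ (Subsemigroup.closure T : Set (M → M)) := by
    intro f hf
    have hc : ∀ s ∈ S, Function.const M s ∈ Subsemigroup.closure T := fun s hs =>
      Subsemigroup.subset_closure (Set.mem_insert_of_mem _ ⟨s, hs, rfl⟩)
    induction hf with
    | id => exact Subsemigroup.subset_closure (Set.mem_insert _ _)
    | const_mul hs _ ih => exact Subsemigroup.mul_mem _ (hc _ hs) ih
    | mul_const hs _ ih => exact Subsemigroup.mul_mem _ ih (hc _ hs)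
    | mul _ _ ih ih' => exact Subsemigroup.mul_mem _ ih ih'
  exact (Cardinal.mk_le_mk_of_subset hle).trans_lt (mk_closure_lt_continuum hT)

/-- In a semigroup of cardinality at most `𝔠` that is not covered by fewer than `𝔠` algebraic
sets, some filter behaves like the trace of the neighborhoods of a zero. -/
theorem exists_zero_filter {M : Type u} [Semigroup M] [Nonempty M] (hM : #M ≤ 𝔠)
    (havoid : ∀ (ι : Type u) (f : ι → M → M) (b : ι → M), #ι < 𝔠 →
      (∀ i, IsPolyFun Set.univ (f i)) → ∃ z, ∀ i, f i z ≠ b i) :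
    ∃ F : Filter M, F.NeBot ∧ (∀ x, {x}ᶜ ∈ F) ∧
      Tendsto (fun p : M × M => p.1 * p.2) (F ×ˢ F) F ∧
      (∀ a, Tendsto (fun x => a * x) F F) ∧ ∀ a, Tendsto (fun x => x * a) F F := by
  obtain ⟨I, _, _, _, hI, hseg⟩ : ∃ (I : Type u) (_ : LinearOrder I) (_ : WellFoundedLT I),
      NoMaxOrder I ∧ #I = 𝔠 ∧ ∀ i : I, #(Set.Iio i) < 𝔠 := by
    refine ⟨(𝔠 : Cardinal.{u}).ord.ToType, inferInstance, inferInstance,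
      Cardinal.noMaxOrder Cardinal.aleph0_le_continuum, Cardinal.mk_ord_toType _, fun i => ?_⟩
    have h := Cardinal.mk_Iio_lt i (by simp)
    rwa [Cardinal.mk_ord_toType] at h
  have hne : Nonempty I := by
    rw [← Cardinal.mk_ne_zero_iff, hI]
    exact Cardinal.continuum_ne_zero
  obtain ⟨x, hx⟩ : ∃ x : I → M, Function.Surjective x := by
    obtain ⟨g⟩ : Nonempty (M ↪ I) := by rwa [← Cardinal.le_def, hI]
    exact ⟨Function.invFun g, Function.invFun_surjective g.injective⟩
  let gen : ∀ i : I, (∀ j, j < i → M) → Set M := fun i prev =>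
    x '' Set.Iio i ∪ Set.range fun j : Set.Iio i => prev j.1 j.2
  have hgen : ∀ i prev, #(gen i prev) < 𝔠 := fun i prev =>
    (Cardinal.mk_union_le _ _).trans_lt (Cardinal.add_lt_of_lt Cardinal.aleph0_le_continuum
      (Cardinal.mk_image_le.trans_lt (hseg i)) (Cardinal.mk_range_le.trans_lt (hseg i)))
  have hstep : ∀ i prev, ∃ w, ∀ f, IsPolyFun (Subsemigroup.closure (gen i prev) : Set M) f →
      ∀ j < i, f w ≠ x j := by
    intro i prev
    obtain ⟨w, hw⟩ := havoid
      ({f | IsPolyFun (Subsemigroup.closure (gen i prev) : Set M) f} × Set.Iio i)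
      (fun p => p.1.1) (fun p => x p.2.1)
      (by
        rw [Cardinal.mk_prod, Cardinal.lift_id, Cardinal.lift_id]
        exact Cardinal.mul_lt_of_lt Cardinal.aleph0_le_continuum
          (mk_isPolyFun_lt_continuum (mk_closure_lt_continuum (hgen i prev))) (hseg i))
      (fun p => p.1.2.mono (Set.subset_univ _))
    exact ⟨w, fun f hf j hj => hw (⟨f, hf⟩, ⟨j, hj⟩)⟩
  choose next hnext using hstep
  obtain ⟨z, hz⟩ : ∃ z : I → M, ∀ i, z i = next i fun j _ => z j :=
    ⟨wellFounded_lt.fix next, wellFounded_lt.fix_eq next⟩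
  let A : I → Subsemigroup M := fun i => Subsemigroup.closure (gen i fun j _ => z j)
  have hzA : ∀ i f, IsPolyFun (A i : Set M) f → ∀ j < i, f (z i) ≠ x j := by
    intro i f hf j hj
    rw [hz i]
    exact hnext i (fun j _ => z j) f hf j hj
  have hA : ∀ {i j}, i ≤ j → A i ≤ A j := by
    intro i j hij
    refine Subsemigroup.closure_mono (Set.union_subset_union ?_ ?_)
    · exact Set.image_mono (Set.Iio_subset_Iio hij)
    · rintro _ ⟨⟨k, hk⟩, rfl⟩
      exact ⟨⟨k, lt_of_lt_of_le hk hij⟩, rfl⟩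
  have hxA : ∀ {i j}, i < j → x i ∈ A j := fun h =>
    Subsemigroup.subset_closure (Or.inl ⟨_, h, rfl⟩)
  have hzA' : ∀ {i j}, i < j → z i ∈ A j := fun {i j} h =>
    Subsemigroup.subset_closure (Or.inr ⟨⟨i, h⟩, rfl⟩)
  have hval : ∀ {i j f}, i < j → IsPolyFun (A i : Set M) f → f (z i) ∈ A j := fun h hf =>
    (hf.mono (hA h.le)).apply_mem (hzA' h)
  let U : I → Set M := fun i => {y | ∃ j ≥ i, ∃ f, IsPolyFun (A j : Set M) f ∧ f (z j) = y}
  have hU : Antitone U := by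
    rintro i j hij y ⟨k, hk, h⟩
    exact ⟨k, hij.trans hk, h⟩
  have hbasis : (⨅ i, 𝓟 (U i)).HasBasis (fun _ => True) U :=
    hasBasis_iInf_principal hU.directed_ge
  refine ⟨⨅ i, 𝓟 (U i), ?_, ?_, ?_, ?_, ?_⟩
  · rw [hbasis.neBot_iff]
    rintro i -
    exact ⟨z i, i, le_rfl, _, .id, rfl⟩
  · intro y
    obtain ⟨i, rfl⟩ := hx y
    obtain ⟨j, hj⟩ := exists_gt i
    refine hbasis.mem_iff.2 ⟨j, trivial, ?_⟩
    rintro _ ⟨k, hk, f, hf, rfl⟩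
    exact hzA k f hf i (lt_of_lt_of_le hj hk)
  · refine ((hbasis.prod_self).tendsto_iff hbasis).2 fun i _ => ⟨i, trivial, ?_⟩
    rintro ⟨_, _⟩ ⟨⟨j, hj, f, hf, rfl⟩, ⟨k, hk, g, hg, rfl⟩⟩
    rcases lt_trichotomy j k with h | rfl | h
    · exact ⟨k, hk, _, .const_mul (hval h hf) hg, rfl⟩
    · exact ⟨j, hj, _, .mul hf hg, rfl⟩
    · exact ⟨j, hj, _, .mul_const (hval h hg) hf, rfl⟩
  · intro a
    obtain ⟨j, rfl⟩ := hx a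
    obtain ⟨k, hk⟩ := exists_gt j
    refine (hbasis.tendsto_iff hbasis).2 fun i _ => ⟨max i k, trivial, ?_⟩
    rintro _ ⟨l, hl, f, hf, rfl⟩
    exact ⟨l, (le_max_left _ _).trans hl, _,
      .const_mul (hxA (hk.trans_le ((le_max_right _ _).trans hl))) hf, rfl⟩
  · intro a
    obtain ⟨j, rfl⟩ := hx a
    obtain ⟨k, hk⟩ := exists_gt j
    refine (hbasis.tendsto_iff hbasis).2 fun i _ => ⟨max i k, trivial, ?_⟩
    rintro _ ⟨l, hl, f, hf, rfl⟩
    exact ⟨l, (le_max_left _ _).trans hl, _,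
      .mul_const (hxA (hk.trans_le ((le_max_right _ _).trans hl))) hf, rfl⟩

/-- The local submonoid `eXe` of an idempotent `e`. -/
def localSubsemigroup {X : Type*} [Semigroup X] (e : X) : Subsemigroup X where
  carrier := {x | e * x = x ∧ x * e = x}
  mul_mem' := fun {a b} ha hb =>
    ⟨by rw [← mul_assoc, ha.1], by rw [mul_assoc, hb.2]⟩

theorem mul_mul_mem_localSubsemigroup {X : Type*} [Semigroup X] {e : X} (he : e * e = e)
    (x : X) : e * x * e ∈ localSubsemigroup e :=
  ⟨by rw [← mul_assoc, ← mul_assoc, he], by rw [mul_assoc, he]⟩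

/-- The value `a₀xa₁x⋯xaₙ`. -/
def seqPolyVal {X : Type*} [Semigroup X] (a : ℕ → X) : ℕ → X → X
  | 0, _ => a 0
  | n + 1, x => seqPolyVal a n x * x * a (n + 1)

theorem seqPolyVal_congr {X : Type*} [Semigroup X] {a b : ℕ → X} {n : ℕ}
    (h : ∀ i ≤ n, a i = b i) (x : X) : seqPolyVal a n x = seqPolyVal b n x := by
  induction n with
  | zero => exact h 0 le_rfl
  | succ n ih =>
    rw [seqPolyVal, seqPolyVal, ih fun i hi => h i (hi.trans n.le_succ), h _ le_rfl]

/-- The functions `x ↦ a₀xa₁x⋯xaₙ` with coefficients in `H`. -/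
inductive IsPolyFunOfDegree {X : Type*} [Semigroup X] (H : Subsemigroup X) : ℕ → (X → X) → Prop
  | const {a : X} : a ∈ H → IsPolyFunOfDegree H 0 fun _ => a
  | step {n : ℕ} {f : X → X} {a : X} : IsPolyFunOfDegree H n f → a ∈ H →
      IsPolyFunOfDegree H (n + 1) fun x => f x * x * a

namespace IsPolyFunOfDegree

variable {X : Type*} [Semigroup X] {H : Subsemigroup X} {m n : ℕ} {f g : X → X}

theorem mul_const (hf : IsPolyFunOfDegree H n f) {b : X} (hb : b ∈ H) :
    IsPolyFunOfDegree H n fun x => f x * b := by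
  cases hf with
  | const ha => exact .const (H.mul_mem ha hb)
  | step hf ha =>
    simp only [mul_assoc _ _ b]
    exact .step hf (H.mul_mem ha hb)

theorem mul (hf : IsPolyFunOfDegree H n f) (hg : IsPolyFunOfDegree H m g) :
    IsPolyFunOfDegree H (n + m) fun x => f x * g x := by
  induction hg with
  | const ha => exact hf.mul_const ha
  | step _ ha ih =>
    simp only [← mul_assoc]
    exact .step ih ha

theorem const_mul {b : X} (hb : b ∈ H) (hf : IsPolyFunOfDegree H n f) :
    IsPolyFunOfDegree H n fun x => b * f x := by
  simpa using (const hb).mul hf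

theorem apply_mem (hf : IsPolyFunOfDegree H n f) {x : X} (hx : x ∈ H) : f x ∈ H := by
  induction hf with
  | const ha => exact ha
  | step _ ha ih => exact H.mul_mem (H.mul_mem ih hx) ha

theorem exists_seqPolyVal (hf : IsPolyFunOfDegree H n f) :
    ∃ a : ℕ → X, (∀ i, a i ∈ H) ∧ f = seqPolyVal a n := by
  induction hf with
  | @const a ha => exact ⟨fun _ => a, fun _ => ha, rfl⟩
  | @step n f b _ hb ih =>
    obtain ⟨a, ha, rfl⟩ := ih
    refine ⟨Function.update a (n + 1) b, fun i => ?_, ?_⟩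
    · by_cases h : i = n + 1
      · rw [h, Function.update_self]; exact hb
      · rw [Function.update_of_ne h]; exact ha i
    · funext x
      rw [seqPolyVal, Function.update_self]
      congr 2
      refine seqPolyVal_congr (fun i hi => ?_) x
      rw [Function.update_of_ne (by omega)]

end IsPolyFunOfDegree

theorem continuous_seqPolyVal {X T : Type*} [Semigroup X] [TopologicalSpace X] [ContinuousMul X]
    [TopologicalSpace T] {a : T → ℕ → X} {x : T → X} (ha : Continuous a) (hx : Continuous x)
    (n : ℕ) : Continuous fun t => seqPolyVal (a t) n (x t) := by
  induction n with
  | zero => exact (continuous_apply 0).comp ha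
  | succ n ih => exact (ih.mul hx).mul ((continuous_apply (n + 1)).comp ha)

theorem IsPolyFun.exists_isPolyFunOfDegree {X : Type*} [Semigroup X] (c : Con X) {e : X}
    (he : e * e = e) {f : c.Quotient → c.Quotient} (hf : IsPolyFun Set.univ f) :
    ∃ (s t : X) (n : ℕ) (g : X → X), 0 < n ∧
      IsPolyFunOfDegree (localSubsemigroup e) n g ∧
      ∀ h ∈ localSubsemigroup e, f (h : c.Quotient) = ((s * g h * t : X) : c.Quotient) := by
  have hee : e ∈ localSubsemigroup e := ⟨he, he⟩
  induction hf with
  | id =>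
    refine ⟨e, e, 1, _, one_pos, .step (.const hee) hee, fun h hh => ?_⟩
    simp only [hh.1, hh.2]
  | const_mul _ _ ih =>
    obtain ⟨s, t, n, g, hn, hg, h⟩ := ih
    rename_i b f _ _
    induction b using Con.induction_on with | _ b
    refine ⟨b * s, t, n, g, hn, hg, fun y hy => ?_⟩
    beta_reduce
    rw [h y hy, ← Con.coe_mul]
    simp only [mul_assoc]
  | mul_const _ _ ih =>
    obtain ⟨s, t, n, g, hn, hg, h⟩ := ih
    rename_i b f _ _
    induction b using Con.induction_on with | _ b
    refine ⟨s, t * b, n, g, hn, hg, fun y hy => ?_⟩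
    beta_reduce
    rw [h y hy, ← Con.coe_mul]
    simp only [mul_assoc]
  | mul _ _ ih ih' =>
    obtain ⟨s, t, n, g, hn, hg, h⟩ := ih
    obtain ⟨s', t', n', g', -, hg', h'⟩ := ih'
    refine ⟨s, t', n + n', _, by omega,
      (hg.mul_const (mul_mul_mem_localSubsemigroup he (t * s'))).mul hg', fun y hy => ?_⟩
    beta_reduce
    rw [h y hy, h' y hy, ← Con.coe_mul]
    congr 1
    calc s * g y * t * (s' * g' y * t') = s * (g y * e) * t * (s' * (e * g' y) * t') := by
          rw [(hg.apply_mem hy).2, (hg'.apply_mem hy).1]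
      _ = s * (g y * (e * (t * s') * e) * g' y) * t' := by simp only [mul_assoc]

theorem polyVal_concat {X : Type*} [Semigroup X] {l : List (WithOne X)} (hl : l ≠ [])
    (b : WithOne X) (x : X) : polyVal (l ++ [b]) x = polyVal l x * (x * b) := by
  cases l with
  | nil => exact absurd rfl hl
  | cons a l => simp [polyVal, mul_assoc]

theorem exists_polyVal_eq_seqPolyVal {X : Type*} [Semigroup X] {e : X}
    {a : ℕ → X} (ha : ∀ i, a i ∈ localSubsemigroup e) {g : X} (hg : g ∈ localSubsemigroup e)
    (n : ℕ) : ∃ l : List (WithOne X), l.length = n + 1 ∧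
      ∀ x, polyVal l x = ((seqPolyVal a n (g * (e * x * e)) : X) : WithOne X) := by
  have key : ∀ n, ∃ l : List (WithOne X), l.length = n + 1 ∧
      ∀ x, polyVal l x = ((seqPolyVal a n (g * (e * x * e)) * g : X) : WithOne X) := by
    intro n
    induction n with
    | zero => exact ⟨[((a 0 * g : X) : WithOne X)], rfl, fun x => by simp [polyVal, seqPolyVal]⟩
    | succ n ih =>
      obtain ⟨l, hl, h⟩ := ih
      refine ⟨l ++ [((a (n + 1) * g : X) : WithOne X)], by simp [hl], fun x => ?_⟩
      rw [polyVal_concat (by rintro rfl; simp at hl), h, seqPolyVal]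
      simp only [← WithOne.coe_mul]
      congr 1
      calc seqPolyVal a n (g * (e * x * e)) * g * (x * (a (n + 1) * g))
          = seqPolyVal a n (g * (e * x * e)) * (g * e) * (x * ((e * a (n + 1)) * g)) := by
            rw [hg.2, (ha _).1]
        _ = _ := by simp only [mul_assoc]
  cases n with
  | zero => exact ⟨[((a 0 : X) : WithOne X)], rfl, fun x => by simp [polyVal, seqPolyVal]⟩
  | succ n =>
    obtain ⟨l, hl, h⟩ := key n
    refine ⟨l ++ [((a (n + 1) : X) : WithOne X)], by simp [hl], fun x => ?_⟩
    rw [polyVal_concat (by rintro rfl; simp at hl), h, seqPolyVal]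
    simp only [← WithOne.coe_mul]
    congr 1
    calc seqPolyVal a n (g * (e * x * e)) * g * (x * a (n + 1))
        = seqPolyVal a n (g * (e * x * e)) * (g * e) * (x * (e * a (n + 1))) := by
          rw [hg.2, (ha _).1]
      _ = _ := by simp only [mul_assoc]

theorem polybounded_of_forall_exists_seqPolyVal_eq {X : Type*} [Semigroup X] {e : X}
    (he : e * e = e) {a g : ℕ → X} (ha : ∀ i, a i ∈ localSubsemigroup e)
    (hg : ∀ i, g i ∈ localSubsemigroup e) {n k : ℕ} (hn : 0 < n)
    (hcov : ∀ x ∈ localSubsemigroup e, ∃ i < k, seqPolyVal a n (g i * x) = e) : Polybounded X := by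
  choose l hl hla using fun i => exists_polyVal_eq_seqPolyVal ha (hg i) n
  refine ⟨(fun i => {x | polyVal (l i) x = (e : WithOne X)}) '' Set.Iio k,
    (Set.finite_Iio k).image _, ?_, ?_⟩
  · rintro _ ⟨i, -, rfl⟩
    exact ⟨l i, e, by rw [hl]; omega, rfl⟩
  · intro x _
    obtain ⟨i, hi, hx⟩ := hcov _ (mul_mul_mem_localSubsemigroup he x)
    refine ⟨_, ⟨i, hi, rfl⟩, ?_⟩
    rw [Set.mem_ofPred_eq, hla, hx]

/-- A congruence which is the kernel of a continuous map to a second countable Hausdorff space. -/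
def IsSecondCountableCon {X : Type u} [Semigroup X] [TopologicalSpace X] (c : Con X) : Prop :=
  ∃ (E : Type u) (_ : TopologicalSpace E), T2Space E ∧ SecondCountableTopology E ∧
    ∃ Φ : X → E, Continuous Φ ∧ ∀ x y, c x y ↔ Φ x = Φ y

theorem exists_isSecondCountableCon_forall {X : Type u} [Semigroup X] [TopologicalSpace X]
    {ι : Type} [Countable ι] {c : ι → Con X} (hc : ∀ i, IsSecondCountableCon (c i)) :
    ∃ d : Con X, IsSecondCountableCon d ∧ ∀ x y, d x y ↔ ∀ i, c i x y := by
  choose E τ hT2 hsc Φ hΦ hcΦ using hc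
  let d : Con X :=
    { r := fun x y => ∀ i, c i x y
      iseqv := ⟨fun x i => (c i).refl x, fun h i => (c i).symm (h i),
        fun h h' i => (c i).trans (h i) (h' i)⟩
      mul' := fun h h' i => (c i).mul (h i) (h' i) }
  refine ⟨d, ⟨∀ i, E i, inferInstance, inferInstance, inferInstance, fun x i => Φ i x,
    continuous_pi hΦ, fun x y => ?_⟩, fun x y => Iff.rfl⟩
  rw [funext_iff]
  exact forall_congr' fun i => hcΦ i x y

theorem exists_isSecondCountableCon_not_rel {X : Type u} [Semigroup X] [TopologicalSpace X]
    [CompactSpace X] [T2Space X] [ContinuousMul X] {x y : X} (hxy : x ≠ y) :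
    ∃ c : Con X, IsSecondCountableCon c ∧ ¬ c x y := by
  obtain ⟨φ, hx, hy, -⟩ := exists_continuous_zero_one_of_isClosed (isClosed_singleton (x := x))
    (isClosed_singleton (x := y)) (by simpa using hxy)
  let L : C(X, C(X, ℝ)) := ContinuousMap.curry ⟨fun p : X × X => φ (p.2 * p.1), by fun_prop⟩
  let R : C(X, C(X, ℝ)) := ContinuousMap.curry ⟨fun p : X × X => φ (p.1 * p.2), by fun_prop⟩
  let B : C(X, C(X × X, ℝ)) :=
    ContinuousMap.curry ⟨fun p : X × (X × X) => φ (p.2.1 * p.1 * p.2.2), by fun_prop⟩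
  let Ψ : X → ℝ × C(X, ℝ) × C(X, ℝ) × C(X × X, ℝ) := fun z => (φ z, L z, R z, B z)
  have hΨ : Continuous Ψ := by fun_prop
  have hΨ' : ∀ z w, Ψ z = Ψ w ↔ φ z = φ w ∧ (∀ a, φ (a * z) = φ (a * w)) ∧
      (∀ b, φ (z * b) = φ (w * b)) ∧ ∀ a b, φ (a * z * b) = φ (a * w * b) := by
    intro z w
    simp only [Ψ, Prod.mk.injEq, ContinuousMap.ext_iff, Prod.forall]
    rfl
  let c : Con X :=
    { r := fun z w => Ψ z = Ψ w
      iseqv := ⟨fun _ => rfl, Eq.symm, Eq.trans⟩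
      mul' := by
        intro w z w' z' h h'
        trans Ψ (z * w')
        · rw [hΨ'] at h ⊢
          refine ⟨h.2.2.1 _, fun a => ?_, fun b => ?_, fun a b => ?_⟩
          · simpa only [mul_assoc] using h.2.2.2 a w'
          · simpa only [mul_assoc] using h.2.2.1 (w' * b)
          · simpa only [mul_assoc] using h.2.2.2 a (w' * b)
        · rw [hΨ'] at h' ⊢
          refine ⟨h'.2.1 _, fun a => ?_, fun b => ?_, fun a b => ?_⟩
          · simpa only [mul_assoc] using h'.2.1 (a * z)
          · simpa only [mul_assoc] using h'.2.2.2 z b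
          · simpa only [mul_assoc] using h'.2.2.2 (a * z) b }
  have : CompactSpace (Set.range Ψ) := isCompact_iff_compactSpace.1 (isCompact_range hΨ)
  refine ⟨c, ⟨Set.range Ψ, inferInstance, inferInstance, inferInstance, Set.rangeFactorization Ψ,
    hΨ.subtype_mk _, fun z w => ⟨fun h => Subtype.ext h, congrArg Subtype.val⟩⟩, fun h => ?_⟩
  have h0 := hx rfl
  have h1 := hy rfl
  rw [((hΨ' x y).1 h).1, h1] at h0
  exact one_ne_zero h0

theorem mk_le_continuum_of_secondCountable (E : Type u) [TopologicalSpace E] [T0Space E]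
    [SecondCountableTopology E] : #E ≤ 𝔠 := by
  let B := TopologicalSpace.countableBasis E
  have hB := TopologicalSpace.isBasis_countableBasis E
  have : Function.Injective fun z : E => {b : B | z ∈ b.1} := fun z w h => by
    refine (hB.inseparable_iff.2 fun s hs => ?_).eq
    exact Set.ext_iff.1 h ⟨s, hs⟩
  calc #E ≤ #(Set B) := mk_le_of_injective this
    _ = 2 ^ #B := mk_set
    _ ≤ 2 ^ ℵ₀ := by
      refine power_le_power_left two_ne_zero ?_
      exact (TopologicalSpace.countable_countableBasis E).le_aleph0
    _ = 𝔠 := two_power_aleph0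

theorem IsSecondCountableCon.mk_quotient_le {X : Type u} [Semigroup X] [TopologicalSpace X]
    {c : Con X} (hc : IsSecondCountableCon c) : #c.Quotient ≤ 𝔠 := by
  obtain ⟨E, _, _, _, Φ, -, h⟩ := hc
  refine (mk_le_of_injective (f := Quotient.lift (s := c.toSetoid) Φ fun x y => (h x y).1) ?_).trans
    (mk_le_continuum_of_secondCountable E)
  rintro ⟨x⟩ ⟨y⟩ hxy
  exact Quotient.sound ((h x y).2 hxy)

theorem isClosed_localSubsemigroup {X : Type*} [Semigroup X] [TopologicalSpace X] [T2Space X]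
    [ContinuousMul X] (e : X) : IsClosed (localSubsemigroup e : Set X) :=
  (isClosed_eq (continuous_const_mul e) continuous_id).inter
    (isClosed_eq (continuous_mul_const e) continuous_id)

theorem IsSecondCountableCon.isClosed_setOf_rel {X T : Type u} [Semigroup X] [TopologicalSpace X]
    [TopologicalSpace T] {c : Con X} (hc : IsSecondCountableCon c) {f g : T → X}
    (hf : Continuous f) (hg : Continuous g) : IsClosed {t | c (f t) (g t)} := by
  obtain ⟨E, _, _, _, Φ, hΦ, h⟩ := hc
  simp only [h]
  exact isClosed_eq (hΦ.comp hf) (hΦ.comp hg)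

/-- If the polynomial covers of length `k` and degree `n` exist modulo every second countable
congruence, then by compactness they exist in `X`. -/
theorem exists_isSecondCountableCon_forall_not_rel {X : Type u} [Semigroup X] [TopologicalSpace X]
    [CompactSpace X] [T2Space X] [ContinuousMul X] {e : X} (he : e * e = e)
    (hX : ¬ Polybounded X) {n : ℕ} (hn : 0 < n) (k : ℕ) :
    ∃ c : Con X, IsSecondCountableCon c ∧ ∀ a g : ℕ → X, (∀ i, a i ∈ localSubsemigroup e) →
      (∀ i, g i ∈ localSubsemigroup e) →
      ∃ h ∈ localSubsemigroup e, ∀ i < k, ¬ c (seqPolyVal a n (g i * h)) e := by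
  by_contra! H
  let ι := {c : Con X // IsSecondCountableCon c}
  let C : ι → Set ((ℕ → X) × (ℕ → X)) := fun c =>
    {p | (∀ i, p.1 i ∈ localSubsemigroup e) ∧ (∀ i, p.2 i ∈ localSubsemigroup e) ∧
      ∀ h ∈ localSubsemigroup e, ∃ i < k, c.1 (seqPolyVal p.1 n (p.2 i * h)) e}
  have hle : ∀ c : ℕ → Con X, (∀ i, IsSecondCountableCon (c i)) →
      ∃ d : ι, ∀ x y, d.1 x y ↔ ∀ i, c i x y := fun c hc =>
    let ⟨d, hd, h⟩ := exists_isSecondCountableCon_forall hc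
    ⟨⟨d, hd⟩, h⟩
  have hanti : ∀ c d : ι, (∀ x y, c.1 x y → d.1 x y) → C c ⊆ C d := fun c d hcd p hp =>
    ⟨hp.1, hp.2.1, fun h hh => let ⟨i, hi, h⟩ := hp.2.2 h hh; ⟨i, hi, hcd _ _ h⟩⟩
  have hdir : Directed (· ⊇ ·) C := by
    intro c d
    obtain ⟨b, hb⟩ := hle (fun i => if i = 0 then c.1 else d.1) fun i => by
      split_ifs
      exacts [c.2, d.2]
    exact ⟨b, hanti _ _ fun x y h => (hb x y).1 h 0, hanti _ _ fun x y h => (hb x y).1 h 1⟩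
  have hclosed : ∀ c, IsClosed (C c) := by
    intro c
    have hL := isClosed_localSubsemigroup e
    have : C c = (⋂ i, {p | p.1 i ∈ localSubsemigroup e}) ∩
        ((⋂ i, {p | p.2 i ∈ localSubsemigroup e}) ∩ ⋂ h ∈ localSubsemigroup e,
          ⋃ i ∈ Set.Iio k, {p | c.1 (seqPolyVal p.1 n (p.2 i * h)) e}) := by
      ext p
      simp [C]
    rw [this]
    refine .inter (isClosed_iInter fun i => ?_) (.inter (isClosed_iInter fun i => ?_)
      (isClosed_biInter fun h _ => (Set.finite_Iio k).isClosed_biUnion fun i _ => ?_))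
    · exact hL.preimage ((continuous_apply i).comp continuous_fst)
    · exact hL.preimage ((continuous_apply i).comp continuous_snd)
    · refine c.2.isClosed_setOf_rel (continuous_seqPolyVal continuous_fst ?_ n) continuous_const
      fun_prop
  have hne : ∀ c, (C c).Nonempty := fun c =>
    let ⟨a, g, ha, hg, h⟩ := H c.1 c.2
    ⟨(a, g), ha, hg, h⟩
  have : Nonempty ι := let ⟨d, _⟩ := hle (fun _ => ⊤) fun _ =>
    ⟨PUnit, inferInstance, inferInstance, inferInstance, fun _ => ⟨⟩, continuous_const,
      fun _ _ => iff_of_true trivial rfl⟩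
    ⟨d⟩
  obtain ⟨⟨a, g⟩, hag⟩ := IsCompact.nonempty_iInter_of_directed_nonempty_isCompact_isClosed C
    hdir hne (fun c => (hclosed c).isCompact) hclosed
  rw [Set.mem_iInter] at hag
  obtain ⟨c₀⟩ := this
  refine hX (polybounded_of_forall_exists_seqPolyVal_eq he (hag c₀).1 (hag c₀).2.1 hn (k := k)
    fun h hh => ?_)
  by_contra! hne
  have : ∀ i, ∃ c : Con X, IsSecondCountableCon c ∧
      (i < k → ¬ c (seqPolyVal a n (g i * h)) e) := fun i => by
    by_cases hi : i < k
    · obtain ⟨c, hc, hc'⟩ := exists_isSecondCountableCon_not_rel (hne i hi)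
      exact ⟨c, hc, fun _ => hc'⟩
    · exact ⟨c₀.1, c₀.2, fun h => absurd h hi⟩
  choose c hc hc' using this
  obtain ⟨d, hd⟩ := hle c hc
  obtain ⟨i, hi, hi'⟩ := (hag d).2.2 h hh
  exact hc' i hi ((hd _ _).1 hi' i)

theorem exists_isSecondCountableCon_forall_forall_not_rel {X : Type u} [Semigroup X]
    [TopologicalSpace X] [CompactSpace X] [T2Space X] [ContinuousMul X] {e : X} (he : e * e = e)
    (hX : ¬ Polybounded X) :
    ∃ c : Con X, IsSecondCountableCon c ∧ ∀ n, 0 < n → ∀ (k : ℕ) (a g : ℕ → X),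
      (∀ i, a i ∈ localSubsemigroup e) → (∀ i, g i ∈ localSubsemigroup e) →
      ∃ h ∈ localSubsemigroup e, ∀ i < k, ¬ c (seqPolyVal a n (g i * h)) e := by
  choose c hc h using fun p : ℕ × ℕ =>
    exists_isSecondCountableCon_forall_not_rel he hX p.1.succ_pos p.2
  obtain ⟨d, hd, hdc⟩ := exists_isSecondCountableCon_forall hc
  refine ⟨d, hd, fun n hn k a g ha hg => ?_⟩
  obtain ⟨n, rfl⟩ := Nat.exists_eq_add_one_of_ne_zero hn.ne'
  obtain ⟨x, hx, hx'⟩ := h (n, k) a g ha hg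
  exact ⟨x, hx, fun i hi hi' => hx' i hi ((hdc _ _).1 hi' (n, k))⟩

theorem rel_seqPolyVal {X : Type*} [Semigroup X] (c : Con X) (a : ℕ → X) (n : ℕ) {x y : X}
    (h : c x y) : c (seqPolyVal a n x) (seqPolyVal a n y) := by
  induction n with
  | zero => exact c.refl _
  | succ n ih => exact c.mul (c.mul ih h) (c.refl _)

/-- If no finitely many translates of `{x | c (f x) e}` cover the compact subgroup
`localSubsemigroup e`, then polynomials are not constant modulo `c` on open sets. -/
theorem IsPolyFunOfDegree.exists_not_rel {X : Type*} [Semigroup X] [TopologicalSpace X]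
    [CompactSpace X] [T2Space X] [ContinuousMul X] {e : X}
    (hinv : ∀ x ∈ localSubsemigroup e, ∃ y ∈ localSubsemigroup e, y * x = e ∧ x * y = e)
    {c : Con X} {n : ℕ} (hc : ∀ (k : ℕ) (a g : ℕ → X),
      (∀ i, a i ∈ localSubsemigroup e) → (∀ i, g i ∈ localSubsemigroup e) →
      ∃ h ∈ localSubsemigroup e, ∀ i < k, ¬ c (seqPolyVal a n (g i * h)) e)
    {f : X → X} (hf : IsPolyFunOfDegree (localSubsemigroup e) n f) {O : Set X} (hO : IsOpen O)
    {x : X} (hx : x ∈ localSubsemigroup e) (hxO : x ∈ O) (b : X) :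
    ∃ h ∈ localSubsemigroup e, h ∈ O ∧ ¬ c (f h) b := by
  by_contra! H
  obtain ⟨y, hy, -, hxy⟩ := hinv _ (hf.apply_mem hx)
  obtain ⟨a, ha, hfa⟩ := (hf.mul_const hy).exists_seqPolyVal
  have hrel : ∀ h ∈ localSubsemigroup e, h ∈ O → c (seqPolyVal a n h) e := by
    intro h hh hhO
    rw [← hfa, ← hxy]
    exact c.mul (c.trans (H h hh hhO) (c.symm (H x hx hxO))) (c.refl y)
  obtain ⟨t, ht⟩ := (isClosed_localSubsemigroup e).isCompact.elim_finite_subcover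
    (fun g : localSubsemigroup e => {h : X | g.1 * h ∈ O})
    (fun g => hO.preimage (continuous_const_mul g.1)) (by
      intro h hh
      obtain ⟨y, hy, hyh, -⟩ := hinv h hh
      refine Set.mem_iUnion.2 ⟨⟨x * y, Subsemigroup.mul_mem _ hx hy⟩, ?_⟩
      change x * y * h ∈ O
      rwa [mul_assoc, hyh, hx.2])
  obtain ⟨h, hh, hnot⟩ := hc t.toList.length a (fun i => (t.toList.getD i ⟨x, hx⟩).1) ha
    fun i => Subtype.prop _
  obtain ⟨g, hg, hgh⟩ := Set.mem_iUnion₂.1 (ht hh)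
  obtain ⟨i, hi, rfl⟩ := List.mem_iff_getElem.1 (Finset.mem_toList.2 hg)
  refine hnot i hi ?_
  rw [List.getD_eq_getElem _ _ hi]
  exact hrel _ (Subsemigroup.mul_mem _ (Subtype.prop _) hh) hgh

theorem IsSecondCountableCon.exists_forall_ne {X : Type u} [Semigroup X] [TopologicalSpace X]
    [CompactSpace X] [T2Space X] [ContinuousMul X] {e : X} (he : e * e = e)
    (hinv : ∀ x ∈ localSubsemigroup e, ∃ y ∈ localSubsemigroup e, y * x = e ∧ x * y = e)
    {c : Con X} (hc : IsSecondCountableCon c) (hcn : ∀ n, 0 < n → ∀ (k : ℕ) (a g : ℕ → X),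
      (∀ i, a i ∈ localSubsemigroup e) → (∀ i, g i ∈ localSubsemigroup e) →
      ∃ h ∈ localSubsemigroup e, ∀ i < k, ¬ c (seqPolyVal a n (g i * h)) e)
    {ι : Type u} (hι : #ι < Cardinal.lift.{u} covMeager) {f : ι → c.Quotient → c.Quotient}
    (hf : ∀ i, IsPolyFun Set.univ (f i)) (b : ι → c.Quotient) : ∃ z, ∀ i, f i z ≠ b i := by
  choose s t n g hn hg hfg using fun i => (hf i).exists_isPolyFunOfDegree c he
  choose b' hb' using fun i => Quotient.exists_rep (s := c.toSetoid) (b i)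
  have hG := fun i => ((hg i).const_mul (mul_mul_mem_localSubsemigroup he (s i))).mul_const
    (mul_mul_mem_localSubsemigroup he (t i))
  choose a ha hga using fun i => (hG i).exists_seqPolyVal
  have hL := (isClosed_localSubsemigroup e).isCompact
  have hrel : ∀ i, ∀ h ∈ localSubsemigroup e, f i (h : c.Quotient) = b i →
      c (seqPolyVal (a i) (n i) h) (e * b' i * e) := by
    intro i h hh hfb
    have h1 : c (s i * g i h * t i) (b' i) := by
      rw [← Con.eq, ← hfg i h hh, hfb, ← hb' i]
      rfl
    have h2 : seqPolyVal (a i) (n i) h = e * (s i * g i h * t i) * e := by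
      rw [← hga]
      calc e * s i * e * g i h * (e * t i * e) = e * s i * (e * g i h * e) * t i * e := by
            simp only [mul_assoc]
        _ = e * s i * g i h * t i * e := by
            rw [((hg i).apply_mem hh).1, ((hg i).apply_mem hh).2]
        _ = _ := by simp only [mul_assoc]
    rw [h2]
    exact c.mul (c.mul (c.refl e) h1) (c.refl e)
  have hclosed : ∀ i, IsClosed {h | c (seqPolyVal (a i) (n i) h) (e * b' i * e)} := fun i =>
    hc.isClosed_setOf_rel (continuous_seqPolyVal continuous_const continuous_id _) continuous_const
  obtain ⟨E, _, _, _, Φ, hΦ, hcΦ⟩ := hc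
  let Z := Φ '' (localSubsemigroup e)
  have : CompactSpace Z := isCompact_iff_compactSpace.1 (hL.image hΦ)
  have : Nonempty Z := ⟨⟨Φ e, e, ⟨he, he⟩, rfl⟩⟩
  obtain ⟨⟨_, h, hh, rfl⟩, hz⟩ := exists_forall_notMem_of_lt_covMeager Z (fun i => Subtype.val ⁻¹'
    (Φ '' (localSubsemigroup e ∩ {h | c (seqPolyVal (a i) (n i) h) (e * b' i * e)}))) hι
    (fun i => (((hL.inter_right (hclosed i)).image hΦ).isClosed).preimage continuous_subtype_val)
    (fun i => by
      by_contra hne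
      obtain ⟨⟨_, x, hx, rfl⟩, hxi⟩ := Set.nonempty_iff_ne_empty.2 hne
      obtain ⟨U, hUsub, hU, hxU⟩ := mem_interior.1 hxi
      obtain ⟨W, hW, rfl⟩ := isOpen_induced_iff.1 hU
      obtain ⟨h, hh, hhW, hnot⟩ := IsPolyFunOfDegree.exists_not_rel hinv (hcn _ (hn i))
        (hga i ▸ hG i) (hW.preimage hΦ) hx hxU (e * b' i * e)
      obtain ⟨h', ⟨-, hrel'⟩, hΦh⟩ := hUsub (a := ⟨Φ h, h, hh, rfl⟩) hhW
      exact hnot (c.trans (rel_seqPolyVal c _ _ (c.symm ((hcΦ _ _).2 hΦh))) hrel'))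
  exact ⟨h, fun i hi => hz i ⟨h, ⟨hh, hrel i h hh hi⟩, rfl⟩⟩

theorem polybounded_of_compactSpace {X : Type u} [Semigroup X] [TopologicalSpace X]
    [CompactSpace X] [T2Space X] [ContinuousMul X] [Nonempty X]
    (hcov : covMeager = Cardinal.continuum) (hX : ZeroDiscretelyClosed X) : Polybounded X := by
  by_contra hpb
  obtain ⟨e, he, hinv⟩ := exists_idempotent_forall_exists_inverse X
  obtain ⟨c, hc, hcn⟩ := exists_isSecondCountableCon_forall_forall_not_rel he hpb
  have : Nonempty c.Quotient := ⟨(e : c.Quotient)⟩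
  obtain ⟨F, hF, hFx, hmul, hl, hr⟩ := exists_zero_filter hc.mk_quotient_le fun ι f b hι hf =>
    hc.exists_forall_ne he (fun x hx => let ⟨y, h₁, h₂, h₃, h₄⟩ := hinv x hx.1 hx.2
      ⟨y, ⟨h₁, h₂⟩, h₃, h₄⟩) hcn (by rwa [hcov, Cardinal.lift_continuum]) hf b
  have hπ : Tendsto ((↑) : X → c.Quotient) (comap (↑) F) F := tendsto_comap
  have hbot := hX.eq_bot (comap ((↑) : X → c.Quotient) F)
    (fun x => mem_of_superset (preimage_mem_comap (hFx x)) fun y hy hyx => hy (congrArg _ hyx))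
    (tendsto_comap_iff.2 (hmul.comp (hπ.prodMap hπ)))
    (fun a => tendsto_comap_iff.2 ((hl a).comp hπ))
    (fun a => tendsto_comap_iff.2 ((hr a).comp hπ))
  have : (comap ((↑) : X → c.Quotient) F).NeBot :=
    hF.comap_of_surj (Quotient.exists_rep (s := c.toSetoid))
  exact this.ne hbot

end

/-- Under `cov(M) = 𝔠`, a subsemigroup `X` of a compact Hausdorff
topological semigroup is polybounded provided the image of `X` is closed under every
injective homomorphism into a compact Hausdorff topological semigroup or a Hausdorff
0-discrete topological semigroup. -/
theorem statement17 {X : Type u} [Semigroup X]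
    (K : Type u) [Semigroup K] [TopologicalSpace K] [CompactSpace K] [T2Space K]
    [ContinuousMul K] (emb : X →ₙ* K) (hemb : Function.Injective emb)
    (hcov : covMeager = Cardinal.continuum)
    (hCompact : ∀ (Y : Type u) [Semigroup Y] [TopologicalSpace Y],
      ∀ [ContinuousMul Y] [CompactSpace Y] [T2Space Y],
      ∀ f : X →ₙ* Y, Function.Injective f → IsClosed (Set.range f))
    (hDiscr : ∀ (Y : Type u) [Semigroup Y] [TopologicalSpace Y],
      ∀ [ContinuousMul Y] [T2Space Y], ∀ z : Y,
      ¬ IsOpen ({z} : Set Y) → (∀ y : Y, y ≠ z → IsOpen ({y} : Set Y)) →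
      (∀ y : Y, z * y = z ∧ y * z = z) →
      ∀ f : X →ₙ* Y, Function.Injective f → IsClosed (Set.range f)) :
    Polybounded X := by
  rcases isEmpty_or_nonempty X with hX | hX
  · exact ⟨∅, Set.finite_empty, by simp, fun x => isEmptyElim x⟩
  let _ : TopologicalSpace X := TopologicalSpace.induced emb inferInstance
  have hind : Topology.IsInducing emb := ⟨rfl⟩
  have hce : Topology.IsClosedEmbedding emb := ⟨⟨hind, hemb⟩, hCompact K emb hemb⟩
  have := hce.compactSpace
  have := hce.isEmbedding.t2Space
  have := hind.continuousMul emb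
  exact polybounded_of_compactSpace hcov hDiscr

end ZeroClosedPaper
end

section
/- Assume cov(N̄) = 𝔠, i.e., the real line is not the union of fewer than continuum many closed sets of Lebesgue measure zero. Let X be a subsemigroup of a compact Hausdorff topological semigroup. Suppose that for every injective homomorphism h : X → Y into a topological semigroup Y that is either compact Hausdorff or Hausdorff 0-discrete, the image h[X] is closed in Y. Then X is polyfinite. -/
open Cardinal Pointwise

universe u

namespace ZeroClosedPaper

section

open MeasureTheory

theorem volume_image_stieltjes_le (f : StieltjesFunction ℝ) (s : Set ℝ) :
    volume (f '' s) ≤ f.measure s := by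
  have h : f.measure s = f.outer s := by rw [StieltjesFunction.measure_def]; rfl
  rw [h, StieltjesFunction.outer, OuterMeasure.ofFunction_apply]
  refine le_iInf₂ fun t ht => ?_
  have hlen : ∀ u : Set ℝ, volume (f '' u) ≤ f.length u := by
    intro u
    rw [StieltjesFunction.length_eq]
    refine le_iInf fun a => le_iInf fun b => le_iInf fun hu => ?_
    have hu' : u ⊆ Set.Ioc a b := by
      intro x hx
      refine hu ⟨hx, fun hb => ?_⟩
      have := hb (x - 1)
      linarith
    have : f '' u ⊆ Set.Icc (f a) (f b) := by
      rintro _ ⟨x, hx, rfl⟩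
      exact ⟨f.mono (hu' hx).1.le, f.mono (hu' hx).2⟩
    exact (measure_mono this).trans_eq Real.volume_Icc
  calc volume (f '' s) ≤ volume (⋃ i, f '' t i) := by
        refine measure_mono ?_
        rw [← Set.image_iUnion]
        exact Set.image_mono ht
    _ ≤ ∑' i, volume (f '' t i) := measure_iUnion_le _
    _ ≤ _ := ENNReal.tsum_le_tsum fun i => hlen _

open TopologicalSpace in
/-- A form of Lusin's theorem. -/
theorem exists_isCompact_continuousOn {Z : Type*} [TopologicalSpace Z] [T2Space Z]
    [MeasurableSpace Z] [BorelSpace Z] (ν : Measure Z) [IsFiniteMeasure ν]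
    [ν.InnerRegularCompactLTTop] [CompactSpace Z] [NeZero ν] {g : Z → ℝ} (hg : Measurable g) :
    ∃ K : Set Z, IsCompact K ∧ ν K ≠ 0 ∧ ContinuousOn g K := by
  have : Countable (countableBasis ℝ) := (countable_countableBasis ℝ).to_subtype
  obtain ⟨ε, hε0, hε⟩ := ENNReal.exists_pos_sum_of_countable' (NeZero.ne (ν Set.univ))
    (countableBasis ℝ)
  have hV : ∀ V : countableBasis ℝ, MeasurableSet (g ⁻¹' V.1) := fun V =>
    hg (isOpen_of_mem_countableBasis V.2).measurableSet
  have hε2 : ∀ V, ε V / 2 ≠ 0 := fun V => (ENNReal.half_pos (hε0 V).ne').ne'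
  choose A hA hAc hAlt using fun V => (hV V).exists_isCompact_lt_add (μ := ν)
    (measure_ne_top _ _) (hε2 V)
  choose B hB hBc hBlt using fun V => (hV V).compl.exists_isCompact_lt_add (μ := ν)
    (measure_ne_top _ _) (hε2 V)
  have hKcl : IsClosed (⋂ V, (A V ∪ B V)) :=
    isClosed_iInter fun V => (hAc V).isClosed.union (hBc V).isClosed
  refine ⟨⋂ V, (A V ∪ B V), hKcl.isCompact, fun h0 => ?_, ?_⟩
  · have h1 : ∀ V, ν (A V ∪ B V)ᶜ ≤ ε V := by
      intro V
      have hsub : (A V ∪ B V)ᶜ ⊆ (g ⁻¹' V.1 \ A V) ∪ ((g ⁻¹' V.1)ᶜ \ B V) := by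
        intro x hx
        simp only [Set.mem_compl_iff, Set.mem_union, not_or] at hx
        by_cases h : x ∈ g ⁻¹' V.1
        · exact Or.inl ⟨h, hx.1⟩
        · exact Or.inr ⟨h, hx.2⟩
      calc ν (A V ∪ B V)ᶜ ≤ _ := measure_mono hsub
        _ ≤ _ := measure_union_le _ _
        _ ≤ ε V / 2 + ε V / 2 := by
          refine add_le_add ?_ ?_
          · rw [measure_sdiff (hA V) (hAc V).measurableSet.nullMeasurableSet
              (measure_ne_top _ _)]
            exact tsub_le_iff_left.2 (hAlt V).le
          · rw [measure_sdiff (hB V) (hBc V).measurableSet.nullMeasurableSet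
              (measure_ne_top _ _)]
            exact tsub_le_iff_left.2 (hBlt V).le
        _ = ε V := ENNReal.add_halves _
    have h2 : ν Set.univ ≤ ∑' V, ε V := by
      calc ν Set.univ ≤ ν (⋂ V, (A V ∪ B V)) + ν (⋂ V, (A V ∪ B V))ᶜ := by
            rw [← Set.union_compl_self (⋂ V, (A V ∪ B V))]
            exact measure_union_le _ _
        _ = ν (⋃ V, (A V ∪ B V)ᶜ) := by rw [h0, zero_add, Set.compl_iInter]
        _ ≤ _ := measure_iUnion_le _
        _ ≤ _ := ENNReal.tsum_le_tsum h1
    exact absurd hε h2.not_gt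
  · rw [continuousOn_iff_continuous_domRestrict]
    refine (isBasis_countableBasis ℝ).continuous_iff.2 fun V hV => ?_
    have : Set.domRestrict (⋂ V, (A V ∪ B V)) g ⁻¹' V = Subtype.val ⁻¹' (B ⟨V, hV⟩)ᶜ := by
      ext ⟨x, hx⟩
      have hx' := Set.mem_iInter.1 hx ⟨V, hV⟩
      constructor
      · intro h1 h2
        exact hB ⟨V, hV⟩ h2 h1
      · intro h1
        exact hA ⟨V, hV⟩ (hx'.resolve_right h1)
    rw [this]
    exact (hBc _).isClosed.isOpen_compl.preimage continuous_subtype_val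

open ProbabilityTheory TopologicalSpace in
/-- Fewer than `cov(N̄)` closed null sets do not cover a compact metrizable space carrying an
atomless finite Borel measure. -/
theorem exists_forall_notMem_of_lt_covClosedNull {Z : Type u} [TopologicalSpace Z]
    [CompactSpace Z] [MetrizableSpace Z] [MeasurableSpace Z] [BorelSpace Z]
    (ν : Measure Z) [IsFiniteMeasure ν] [NeZero ν] [NullSingletonClass ν]
    (hcov : covClosedNull = Cardinal.continuum) {ι : Type u} (S : ι → Set Z)
    (hcl : ∀ i, IsClosed (S i)) (hnull : ∀ i, ν (S i) = 0)
    (hι : Cardinal.mk ι < Cardinal.continuum) : ∃ z, ∀ i, z ∉ S i := by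
  by_contra! hS
  let := metrizableSpaceMetric Z
  have : PolishSpace Z := inferInstance
  have hemb := measurableEmbedding_embeddingReal Z
  set g := embeddingReal Z
  obtain ⟨K, hK, hνK, hgK⟩ := exists_isCompact_continuousOn ν hemb.measurable
  have : IsProbabilityMeasure (ν[|K]) := cond_isProbabilityMeasure hνK
  have : IsProbabilityMeasure ((ν[|K]).map g) :=
    Measure.isProbabilityMeasure_map hemb.measurable.aemeasurable
  have hmap : ∀ s, (ν[|K]).map g s = ν[g ⁻¹' s | K] := fun s => hemb.map_apply _ _
  set ρ := (ν[|K]).map g with hρ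
  have hac : ∀ s : Set Z, ν (K ∩ s) = 0 → ν[s | K] = 0 := fun s hs => by
    rw [cond_apply hK.measurableSet, hs, mul_zero]
  have hatom : ∀ t, ρ {t} = 0 := fun t => by
    rw [hmap]
    refine hac _ (Set.Subsingleton.measure_zero ?_ _)
    intro x hx y hy
    exact hemb.injective (hx.2.trans hy.2.symm)
  have hF : (cdf ρ).measure = ρ := measure_cdf ρ
  have hFc : Continuous (cdf ρ) := by
    refine continuous_iff_continuousAt.2 fun t => ?_
    rw [(cdf ρ).mono.continuousAt_iff_leftLim_eq_rightLim, (cdf ρ).rightLim_eq]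
    have h1 := StieltjesFunction.measure_singleton (cdf ρ) t
    rw [hF, hatom, eq_comm, ENNReal.ofReal_eq_zero] at h1
    exact le_antisymm ((cdf ρ).mono.leftLim_le le_rfl) (by linarith)
  have himg : ∀ s : Set ℝ, volume (cdf ρ '' s) ≤ ρ s := fun s => by
    have := volume_image_stieltjes_le (cdf ρ) s
    rwa [hF] at this
  have hcpt : ∀ i, IsCompact ((fun z => cdf ρ (g z)) '' (K ∩ S i)) := fun i =>
    (hK.inter_right (hcl i)).image_of_continuousOn
      (hFc.comp_continuousOn (hgK.mono Set.inter_subset_left))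
  have hnull' : ∀ i, volume ((fun z => cdf ρ (g z)) '' (K ∩ S i)) = 0 := by
    intro i
    have : (fun z => cdf ρ (g z)) '' (K ∩ S i) = cdf ρ '' (g '' (K ∩ S i)) := by
      rw [Set.image_image]
    rw [this]
    refine le_antisymm ((himg _).trans_eq ?_) zero_le
    rw [hmap, Set.preimage_image_eq _ hemb.injective]
    exact hac _ (measure_mono_null (fun x hx => hx.2.2) (hnull i))
  have hCcpt : IsCompact ((fun z => cdf ρ (g z)) '' K) :=
    hK.image_of_continuousOn (hFc.comp_continuousOn hgK)
  have hIoo : Set.Ioo (0 : ℝ) 1 ⊆ (fun z => cdf ρ (g z)) '' K := by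
    have hopen : IsOpen (Set.Ioo (0 : ℝ) 1 \ (fun z => cdf ρ (g z)) '' K) :=
      isOpen_Ioo.sdiff hCcpt.isClosed
    have hnul : volume (Set.Ioo (0 : ℝ) 1 \ (fun z => cdf ρ (g z)) '' K) = 0 := by
      refine le_antisymm ?_ zero_le
      calc volume (Set.Ioo (0 : ℝ) 1 \ (fun z => cdf ρ (g z)) '' K)
          ≤ volume (cdf ρ '' (g '' K)ᶜ) := by
            refine measure_mono ?_
            rintro t ⟨⟨ht0, ht1⟩, htK⟩
            obtain ⟨a, ha⟩ := ((tendsto_cdf_atBot ρ).eventually (gt_mem_nhds ht0)).exists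
            obtain ⟨b, hb⟩ := ((tendsto_cdf_atTop ρ).eventually (lt_mem_nhds ht1)).exists
            obtain ⟨c, hc⟩ := mem_range_of_exists_le_of_exists_ge hFc ⟨a, ha.le⟩ ⟨b, hb.le⟩
            refine ⟨c, ?_, hc⟩
            rintro ⟨z, hz, rfl⟩
            exact htK ⟨z, hz, hc⟩
        _ ≤ ρ (g '' K)ᶜ := himg _
        _ = 0 := by
          rw [hmap, Set.preimage_compl, Set.preimage_image_eq _ hemb.injective]
          exact hac _ (by simp)
    have := hopen.eq_empty_of_measure_zero hnul
    exact Set.sdiff_eq_empty.1 this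
  have hIcc : Set.Icc (0 : ℝ) 1 ⊆ (fun z => cdf ρ (g z)) '' K := by
    rw [← closure_Ioo (zero_ne_one)]
    exact closure_minimal hIoo hCcpt.isClosed
  set R : ι × ℤ → Set ℝ := fun p =>
    (fun x : ℝ => x - p.2) ⁻¹' ((fun z => cdf ρ (g z)) '' (K ∩ S p.1)) with hR
  have hle : covClosedNull ≤ Cardinal.mk (Set.range R) := by
    refine csInf_le' ⟨Set.range R, ?_, ?_, rfl⟩
    · rintro _ ⟨p, rfl⟩
      refine ⟨(hcpt p.1).isClosed.preimage (by fun_prop), ?_⟩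
      have := (measurePreserving_sub_right volume (p.2 : ℝ)).measure_preimage
        (hcpt p.1).measurableSet.nullMeasurableSet
      exact this.trans (hnull' _)
    · refine Set.eq_univ_of_forall fun x => ?_
      obtain ⟨z, hz, hzx⟩ := hIcc ⟨Int.fract_nonneg x, (Int.fract_lt_one x).le⟩
      obtain ⟨i, hi⟩ := hS z
      exact ⟨_, ⟨(i, ⌊x⌋), rfl⟩, z, ⟨hz, hi⟩, hzx⟩
  have h1 := mk_range_le_lift (f := R)
  have h2 : Cardinal.mk (ι × ℤ) < Cardinal.continuum := by
    rw [Cardinal.mk_prod]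
    refine Cardinal.mul_lt_of_lt Cardinal.aleph0_le_continuum (by simpa using hι) ?_
    simpa using Cardinal.aleph0_lt_continuum
  have h3 : Cardinal.lift.{u} (Cardinal.mk (Set.range R)) < Cardinal.continuum.{u} := by
    refine lt_of_le_of_lt h1 ?_
    simpa using h2
  rw [hcov] at hle
  have := Cardinal.lift_le.{u}.2 hle
  rw [Cardinal.lift_continuum] at this
  exact absurd h3 this.not_gt

/-- A compact Hausdorff topological semigroup contains an idempotent `e` such that every element
`e * x * e` is invertible in the monoid `eXe`. -/
theorem exists_idempotent_forall_left_inverse (X : Type*) [Semigroup X] [TopologicalSpace X]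
    [CompactSpace X] [T2Space X] [ContinuousMul X] [Nonempty X] :
    ∃ e : X, e * e = e ∧ ∀ x, e * x = x → x * e = x → ∃ y, e * y = y ∧ y * e = y ∧ y * x = e := by
  let S : Set (Set X) := {N | IsClosed N ∧ N.Nonempty ∧ ∀ m ∈ N, ∀ a, a * m ∈ N}
  obtain ⟨L, hL⟩ : ∃ L, Minimal (· ∈ S) L := by
    refine zorn_superset _ fun c hcs hc => ?_
    refine ⟨⋂₀ c, ⟨isClosed_sInter fun t ht => (hcs ht).1, ?_, fun m hm a => ?_⟩, fun s hs =>
      Set.sInter_subset_of_mem hs⟩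
    · obtain rfl | hcnemp := c.eq_empty_or_nonempty
      · rw [Set.sInter_empty]
        exact Set.univ_nonempty
      · have := hcnemp.coe_sort
        exact IsCompact.nonempty_sInter_of_directed_nonempty_isCompact_isClosed
          (IsChain.directedOn hc.symm) (fun i hi => (hcs hi).2.1) (fun i hi => (hcs hi).1.isCompact)
          (fun i hi => (hcs hi).1)
    · rw [Set.mem_sInter]
      exact fun t ht => (hcs ht).2.2 m (Set.mem_sInter.mp hm t ht) a
  obtain ⟨e, heL, he⟩ := exists_idempotent_in_compact_subsemigroup
    (fun r : X => continuous_mul_const r) L hL.prop.2.1 hL.prop.1.isCompact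
    (fun x _ y hy => hL.prop.2.2 y hy x)
  refine ⟨e, he, fun x hex hxe => ?_⟩
  have hxL : x ∈ L := by
    rw [← hxe]
    exact hL.prop.2.2 e heL x
  have hXx : (fun y => y * x) '' Set.univ = L := by
    refine hL.eq_of_subset ⟨(isCompact_univ.image (continuous_mul_const x)).isClosed,
      ⟨_, ⟨x, trivial, rfl⟩⟩, ?_⟩ ?_
    · rintro _ ⟨y, -, rfl⟩ a
      exact ⟨a * y, trivial, mul_assoc _ _ _⟩
    · rintro _ ⟨y, -, rfl⟩
      exact hL.prop.2.2 x hxL y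
  rw [← hXx] at heL
  obtain ⟨y, -, hy⟩ := heL
  refine ⟨e * y * e, ?_, ?_, ?_⟩
  · rw [← mul_assoc, ← mul_assoc, he]
  · rw [mul_assoc, he]
  · rw [mul_assoc, hex, mul_assoc]
    exact (congrArg (e * ·) hy).trans he

theorem exists_compact_group (X : Type u) [Semigroup X] [TopologicalSpace X]
    [CompactSpace X] [T2Space X] [ContinuousMul X] [Nonempty X] :
    ∃ (G : Type u) (_ : Group G) (_ : TopologicalSpace G) (_ : IsTopologicalGroup G)
      (_ : CompactSpace G) (_ : T2Space G) (i : G →ₙ* X), Continuous i ∧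
      ∀ x, ∃ g : G, i 1 * x * i 1 = i g := by
  obtain ⟨e, he, hinv⟩ := exists_idempotent_forall_left_inverse X
  let G : Type u := {x : X // e * x = x ∧ x * e = x}
  have hmul : ∀ a b : X, (e * a = a ∧ a * e = a) → (e * b = b ∧ b * e = b) →
      e * (a * b) = a * b ∧ a * b * e = a * b := fun a b ha hb =>
    ⟨by rw [← mul_assoc, ha.1], by rw [mul_assoc, hb.2]⟩
  have hinv' : ∀ x : G, ∃ y : G, y.1 * x.1 = e := fun x => by
    obtain ⟨y, h1, h2, h3⟩ := hinv x.1 x.2.1 x.2.2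
    exact ⟨⟨y, h1, h2⟩, h3⟩
  choose inv hinv using hinv'
  let : Mul G := ⟨fun a b => ⟨a.1 * b.1, hmul _ _ a.2 b.2⟩⟩
  let : One G := ⟨⟨e, he, he⟩⟩
  let : Inv G := ⟨inv⟩
  let : Group G := Group.ofLeftAxioms
    (fun a b c => Subtype.ext (mul_assoc a.1 b.1 c.1))
    (fun a => Subtype.ext a.2.1) (fun a => Subtype.ext (hinv a))
  have : ContinuousMul G := ⟨by
    exact Continuous.subtype_mk ((continuous_subtype_val.comp continuous_fst).mul
      (continuous_subtype_val.comp continuous_snd)) _⟩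
  have hcl : IsClosed {x : X | e * x = x ∧ x * e = x} :=
    (isClosed_eq (by fun_prop) (by fun_prop)).inter (isClosed_eq (by fun_prop) (by fun_prop))
  have : CompactSpace G := isCompact_iff_compactSpace.1 hcl.isCompact
  have : ContinuousInv G := ⟨by
    refine continuous_iff_isClosed.2 fun s hs => ?_
    have h1 : IsClosed {p : G × G | p.1 * p.2 = 1 ∧ p.2 ∈ s} :=
      (isClosed_eq (by fun_prop) (by fun_prop)).inter (hs.preimage continuous_snd)
    have h2 : (fun g : G => g⁻¹) ⁻¹' s = Prod.fst '' {p : G × G | p.1 * p.2 = 1 ∧ p.2 ∈ s} := by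
      ext g
      constructor
      · intro hg
        exact ⟨(g, g⁻¹), ⟨mul_inv_cancel g, hg⟩, rfl⟩
      · rintro ⟨⟨g, h⟩, ⟨h1, h2⟩, rfl⟩
        rw [Set.mem_preimage, inv_eq_of_mul_eq_one_right h1]
        exact h2
    rw [h2]
    exact (h1.isCompact.image continuous_fst).isClosed⟩
  refine ⟨G, inferInstance, inferInstance, {}, inferInstance, inferInstance,
    ⟨Subtype.val, fun _ _ => rfl⟩, continuous_subtype_val, fun x => ?_⟩
  exact ⟨⟨e * x * e, by rw [← mul_assoc, ← mul_assoc, he], by rw [mul_assoc, he]⟩, rfl⟩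

section WithOneTopology

open Topology

variable {X : Type*} [TopologicalSpace X]

instance : TopologicalSpace (WithOne X) := inferInstanceAs (TopologicalSpace (OnePoint X))

instance : CompactSpace (WithOne X) := inferInstanceAs (CompactSpace (OnePoint X))

instance [CompactSpace X] [T2Space X] : T2Space (WithOne X) :=
  inferInstanceAs (T2Space (OnePoint X))

theorem isOpenEmbedding_coe_withOne : IsOpenEmbedding ((↑) : X → WithOne X) :=
  OnePoint.isOpenEmbedding_coe

theorem nhds_one_withOne [CompactSpace X] : 𝓝 (1 : WithOne X) = pure 1 := by
  have : IsOpen ({1} : Set (WithOne X)) := by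
    have h : ({1} : Set (WithOne X)) = (((↑) : X → OnePoint X) '' Set.univ)ᶜ := by
      rw [OnePoint.compl_image_coe]
      simp
      rfl
    rw [h]
    exact OnePoint.isOpen_compl_image_coe.2 ⟨isClosed_univ, isCompact_univ⟩
  exact (isOpen_singleton_iff_nhds_eq_pure _).1 this

instance [CompactSpace X] [T2Space X] [Semigroup X] [ContinuousMul X] :
    ContinuousMul (WithOne X) := ⟨by
  refine continuous_iff_continuousAt.2 fun ⟨a, b⟩ => ?_
  have hcoe := (isOpenEmbedding_coe_withOne (X := X)).map_nhds_eq
  rw [ContinuousAt, nhds_prod_eq]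
  induction a using WithOne.recOneCoe with
  | one =>
    rw [nhds_one_withOne, Filter.pure_prod, Filter.tendsto_map'_iff]
    simp only [Function.comp_def, one_mul]
    exact Filter.tendsto_id
  | coe a =>
    induction b using WithOne.recOneCoe with
    | one =>
      rw [nhds_one_withOne, Filter.prod_pure, Filter.tendsto_map'_iff]
      simp only [Function.comp_def, mul_one]
      exact Filter.tendsto_id
    | coe b =>
      rw [← hcoe, ← hcoe, Filter.prod_map_map_eq, Filter.tendsto_map'_iff, ← nhds_prod_eq]
      have := (isOpenEmbedding_coe_withOne (X := X)).continuous.comp (continuous_mul (M := X))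
      exact this.tendsto (a, b)⟩

end WithOneTopology

/-- A compactly parametrized family of null level sets stays null after replacing the equation by
its images under countably many continuous real functions. -/
theorem exists_countable_forall_measure_eq_zero {P W G : Type*} [TopologicalSpace P]
    [CompactSpace P] [TopologicalSpace W] [CompactSpace W] [T2Space W] [TopologicalSpace G]
    [CompactSpace G] [MeasurableSpace G] (μ : Measure G) [μ.OuterRegular]
    {ψ : P × G → W} (hψ : Continuous ψ) {β : P → W} (hβ : Continuous β)
    (hnull : ∀ p, μ {g | ψ (p, g) = β p} = 0) :
    ∃ F : Set C(W, ℝ), F.Countable ∧ ∀ p, μ {g | ∀ f ∈ F, f (ψ (p, g)) = f (β p)} = 0 := by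
  have key : ∀ ε : ENNReal, 0 < ε → ∃ F : Set C(W, ℝ), F.Finite ∧
      ∀ p, μ {g | ∀ f ∈ F, f (ψ (p, g)) = f (β p)} ≤ ε := by
    intro ε hε
    have hloc : ∀ p : P, ∃ F : Set C(W, ℝ), F.Finite ∧ ∃ N ∈ nhds p,
        ∀ q ∈ N, μ {g | ∀ f ∈ F, f (ψ (q, g)) = f (β q)} ≤ ε := by
      intro p
      obtain ⟨O, hO, hOo, hOε⟩ := Set.exists_isOpen_lt_of_lt {g | ψ (p, g) = β p} ε
        ((hnull p).trans_lt hε)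
      let V : C(W, ℝ) → Set (P × G) := fun f => {x | f (ψ x) ≠ f (β x.1)}
      have hV : ∀ f, IsOpen (V f) := fun f =>
        isOpen_ne_fun (f.continuous.comp hψ) (f.continuous.comp (hβ.comp continuous_fst))
      have hcpt : IsCompact (({p} : Set P) ×ˢ Oᶜ) :=
        isCompact_singleton.prod hOo.isClosed_compl.isCompact
      obtain ⟨t, ht⟩ := hcpt.elim_finite_subcover V hV (by
        rintro ⟨p', g⟩ ⟨hp, hg⟩
        obtain rfl : p' = p := hp
        have hne : ψ (p', g) ≠ β p' := fun h => hg (hO h)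
        obtain ⟨f, h0, h1, -⟩ := exists_continuous_zero_one_of_isClosed
          (isClosed_singleton (x := ψ (p', g))) (isClosed_singleton (x := β p'))
          (by simpa using hne)
        refine Set.mem_iUnion.2 ⟨f, ?_⟩
        have e0 : f (ψ (p', g)) = 0 := h0 rfl
        have e1 : f (β p') = 1 := h1 rfl
        change f (ψ (p', g)) ≠ f (β p')
        rw [e0, e1]
        exact zero_ne_one)
      obtain ⟨A, B, hA, -, hpA, hOB, hAB⟩ := generalized_tube_lemma isCompact_singleton
        hOo.isClosed_compl.isCompact (isOpen_biUnion fun f (_ : f ∈ t) => hV f) ht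
      refine ⟨t, t.finite_toSet, A, hA.mem_nhds (hpA rfl), fun q hq => ?_⟩
      refine (measure_mono ?_).trans hOε.le
      intro g hg
      by_contra hgO
      obtain ⟨f, hf, hfg⟩ := Set.mem_iUnion₂.1 (hAB (Set.mk_mem_prod hq (hOB hgO)))
      exact hfg (hg f hf)
    choose F hF N hN hNF using hloc
    obtain ⟨t, ht⟩ := CompactSpace.elim_nhds_subcover N hN
    refine ⟨⋃ p ∈ t, F p, t.finite_toSet.biUnion fun p _ => hF p, fun q => ?_⟩
    obtain ⟨p, hp, hq⟩ := Set.mem_iUnion₂.1 (ht.symm ▸ Set.mem_univ q : q ∈ ⋃ x ∈ t, N x)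
    refine (measure_mono ?_).trans (hNF p q hq)
    exact fun g hg f hf => hg f (Set.mem_biUnion hp hf)
  choose F hF hFε using fun n : ℕ => key ((n : ENNReal) + 1)⁻¹
    (ENNReal.inv_pos.2 (by finiteness))
  refine ⟨⋃ n, F n, Set.countable_iUnion fun n => (hF n).countable, fun p => ?_⟩
  refine le_antisymm (ENNReal.le_of_forall_pos_le_add fun ε hε _ => ?_) zero_le
  obtain ⟨n, hn⟩ := ENNReal.exists_inv_nat_lt (a := (ε : ENNReal)) (by simpa using hε.ne')
  rw [zero_add]
  refine le_trans ?_ hn.le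
  refine ((measure_mono ?_).trans (hFε n p)).trans (ENNReal.inv_le_inv.2 le_self_add)
  exact fun g hg f hf => hg f (Set.mem_iUnion.2 ⟨n, hf⟩)

theorem continuous_polyVal {X : Type*} [Semigroup X] [TopologicalSpace X] [CompactSpace X]
    [T2Space X] [ContinuousMul X] (n : ℕ) :
    Continuous fun p : (Fin (n + 1) → WithOne X) × X => polyVal (List.ofFn p.1) p.2 := by
  have h : (fun p : (Fin (n + 1) → WithOne X) × X => polyVal (List.ofFn p.1) p.2) = fun p =>
      p.1 0 * ((List.finRange n).map fun i => (p.2 : WithOne X) * p.1 i.succ).prod := by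
    funext p
    rw [List.ofFn_succ]
    simp [polyVal, List.ofFn_eq_map, Function.comp_def]
  rw [h]
  have hcoe := (isOpenEmbedding_coe_withOne (X := X)).continuous
  refine Continuous.mul (by fun_prop) (continuous_list_prod _ fun i _ => ?_)
  exact (hcoe.comp continuous_snd).mul (by fun_prop)

/-- A compact topological semigroup has a metrizable quotient in which prescribed polynomial level
sets remain null. -/
theorem exists_metrizable_congruence {X G : Type u} [Semigroup X] [TopologicalSpace X]
    [CompactSpace X] [T2Space X] [ContinuousMul X] [TopologicalSpace G] [CompactSpace G]
    [MeasurableSpace G] (μ : Measure G) [μ.OuterRegular] {i : G → X} (hi : Continuous i)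
    (hnull : ∀ (a : List (WithOne X)) (b : WithOne X), 2 ≤ a.length →
      μ {g | polyVal a (i g) = b} = 0) :
    ∃ (T : Type u) (_ : TopologicalSpace T) (_ : TopologicalSpace.MetrizableSpace T)
      (Φ : WithOne X → T), Continuous Φ ∧
      (∀ x x' y y', Φ x = Φ x' → Φ y = Φ y' → Φ (x * y) = Φ (x' * y')) ∧
      ∀ (a : List (WithOne X)) (b : WithOne X), 2 ≤ a.length →
        μ {g | Φ (polyVal a (i g)) = Φ b} = 0 := by
  have hn : ∀ n : ℕ, ∃ F : Set C(WithOne X, ℝ), F.Countable ∧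
      ∀ (a : List (WithOne X)) (b : WithOne X), a.length = n + 2 →
        μ {g | ∀ f ∈ F, f (polyVal a (i g)) = f b} = 0 := by
    intro n
    obtain ⟨F, hF, h⟩ := exists_countable_forall_measure_eq_zero μ
      (P := (Fin (n + 1 + 1) → WithOne X) × WithOne X)
      (ψ := fun p => polyVal (List.ofFn p.1.1) (i p.2)) (β := Prod.snd)
      ((continuous_polyVal (n + 1)).comp
        ((continuous_fst.comp continuous_fst).prodMk (hi.comp continuous_snd)))
      continuous_snd (fun p => hnull (List.ofFn p.1) p.2 (by simp))
    refine ⟨F, hF, fun a b ha => ?_⟩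
    have := h (fun j => a.get (j.cast ha.symm), b)
    have ha' : List.ofFn (fun j : Fin (n + 1 + 1) => a.get (j.cast ha.symm)) = a := by
      refine List.ext_get (by simp [ha]) fun k h1 h2 => ?_
      simp [-List.ofFn_succ]
    simpa only [ha'] using this
  choose F hF hFnull using hn
  have hcount : (insert 0 (⋃ n, F n)).Countable := (Set.countable_iUnion hF).insert 0
  obtain ⟨f, hf⟩ := hcount.exists_eq_range (Set.insert_nonempty _ _)
  let H : ℕ → C(WithOne X × (WithOne X × WithOne X), ℝ) := fun n =>
    ⟨fun p => f n (p.2.1 * p.1 * p.2.2), by fun_prop⟩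
  have hΦ : ∀ x y, (∀ n, (H n).curry x = (H n).curry y) ↔
      ∀ n c d, f n (c * x * d) = f n (c * y * d) := by
    intro x y
    refine forall_congr' fun n => ?_
    constructor
    · intro h c d
      exact congrArg (fun u : C(WithOne X × WithOne X, ℝ) => u (c, d)) h
    · intro h
      ext ⟨c, d⟩
      exact h c d
  refine ⟨ℕ → C(WithOne X × WithOne X, ℝ), inferInstance, inferInstance,
    fun x n => (H n).curry x, continuous_pi fun n => (H n).curry.continuous, ?_, ?_⟩
  · intro x x' y y' hx hy
    have hx := (hΦ _ _).1 (congrFun hx)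
    have hy := (hΦ _ _).1 (congrFun hy)
    refine funext ((hΦ _ _).2 fun n c d => ?_)
    calc f n (c * (x * y) * d) = f n (c * x * (y * d)) := by simp only [mul_assoc]
      _ = f n (c * x' * (y * d)) := hx n _ _
      _ = f n (c * x' * y * d) := by simp only [mul_assoc]
      _ = f n (c * x' * y' * d) := hy n _ _
      _ = f n (c * (x' * y') * d) := by simp only [mul_assoc]
  · intro a b ha
    refine measure_mono_null ?_ (hFnull (a.length - 2) a b (by omega))
    intro g hg φ hφ
    obtain ⟨n, rfl⟩ : φ ∈ Set.range f := hf ▸ Or.inr (Set.mem_iUnion.2 ⟨_, hφ⟩)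
    simpa using (hΦ _ _).1 (congrFun hg) n 1 1

section Polynomials

variable {X : Type*} [Semigroup X]

theorem polyVal_cons (c : WithOne X) {a : List (WithOne X)} (ha : a ≠ []) (x : X) :
    polyVal (c :: a) x = c * x * polyVal a x := by
  cases a with
  | nil => exact absurd rfl ha
  | cons d l => simp [polyVal, mul_assoc]

theorem polyVal_singleton (c : WithOne X) (x : X) : polyVal [c] x = c := by
  simp [polyVal]

theorem polyVal_mem (N : Submonoid (WithOne X)) {x : X} (hx : (x : WithOne X) ∈ N) :
    ∀ a : List (WithOne X), (∀ c ∈ a, c ∈ N) → polyVal a x ∈ N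
  | [], _ => N.one_mem
  | [c], h => by
    rw [polyVal_singleton]
    exact h c (by simp)
  | c :: d :: l, h => by
    rw [polyVal_cons c (by simp)]
    exact N.mul_mem (N.mul_mem (h c (by simp)) hx)
      (polyVal_mem N hx (d :: l) fun e he => h e (List.mem_cons_of_mem _ he))

theorem exists_polyVal_eq_mul (N : Submonoid (WithOne X)) {b : List (WithOne X)} (hb : b ≠ [])
    (hbN : ∀ c ∈ b, c ∈ N) :
    ∀ a : List (WithOne X), a ≠ [] → (∀ c ∈ a, c ∈ N) →
      ∃ c : List (WithOne X), c.length + 1 = a.length + b.length ∧ (∀ d ∈ c, d ∈ N) ∧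
        ∀ x, polyVal c x = polyVal a x * polyVal b x
  | [], h, _ => absurd rfl h
  | [c], _, h => by
    cases b with
    | nil => exact absurd rfl hb
    | cons d l =>
      refine ⟨c * d :: l, by simp [add_comm], ?_, fun x => by simp [polyVal, mul_assoc]⟩
      intro e he
      rcases List.mem_cons.1 he with rfl | he
      · exact N.mul_mem (h c (by simp)) (hbN d (by simp))
      · exact hbN e (List.mem_cons_of_mem _ he)
  | c :: d :: l, _, h => by
    obtain ⟨e, he, heN, hx⟩ := exists_polyVal_eq_mul N hb hbN (d :: l) (by simp)
      fun e he => h e (List.mem_cons_of_mem _ he)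
    have hne : e ≠ [] := by
      rintro rfl
      have := List.length_pos_iff.2 hb
      simp at he
      omega
    refine ⟨c :: e, ?_, ?_, fun x => ?_⟩
    · simp only [List.length_cons] at he ⊢
      omega
    · intro f hf
      rcases List.mem_cons.1 hf with rfl | hf
      · exact h f (by simp)
      · exact heN f hf
    · rw [polyVal_cons c hne, polyVal_cons c (by simp), hx, mul_assoc _ _ (polyVal b x)]

/-- `p` is a polynomial function with `n` occurrences of the variable. -/
def IsPolyFun_s18 (n : ℕ) (p : X → WithOne X) : Prop :=
  ∃ a : List (WithOne X), a.length = n + 1 ∧ ∀ x, polyVal a x = p x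

theorem IsPolyFun_s18.const (c : WithOne X) : IsPolyFun_s18 0 fun _ : X => c :=
  ⟨[c], rfl, polyVal_singleton c⟩

theorem IsPolyFun_s18.id : IsPolyFun_s18 1 ((↑) : X → WithOne X) :=
  ⟨[1, 1], rfl, fun x => by simp [polyVal]⟩

theorem IsPolyFun_s18.mul {m n : ℕ} {p q : X → WithOne X} (hp : IsPolyFun_s18 m p) (hq : IsPolyFun_s18 n q) :
    IsPolyFun_s18 (m + n) fun x => p x * q x := by
  obtain ⟨a, ha, hp⟩ := hp
  obtain ⟨b, hb, hq⟩ := hq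
  obtain ⟨c, hc, -, hx⟩ := exists_polyVal_eq_mul ⊤ (List.ne_nil_of_length_eq_add_one hb)
    (by simp) a (List.ne_nil_of_length_eq_add_one ha) (by simp)
  exact ⟨c, by omega, fun x => by rw [hx, hp, hq]⟩

theorem IsPolyFun_s18.pow {n : ℕ} {p : X → WithOne X} (hp : IsPolyFun_s18 n p) (k : ℕ) :
    IsPolyFun_s18 (n * k) fun x => p x ^ k := by
  induction k with
  | zero => simpa using IsPolyFun_s18.const (1 : WithOne X)
  | succ k ih => simpa only [pow_succ, Nat.mul_succ] using ih.mul hp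

theorem IsPolyFun_s18.comp {n : ℕ} {p : X → X} (hp : IsPolyFun_s18 n fun x => (p x : WithOne X)) :
    ∀ a : List (WithOne X), a ≠ [] → IsPolyFun_s18 (n * (a.length - 1)) fun x => polyVal a (p x)
  | [], h => absurd rfl h
  | [c], _ => by simpa [polyVal_singleton] using IsPolyFun_s18.const c
  | c :: d :: l, _ => by
    have := ((IsPolyFun_s18.const c).mul hp).mul (IsPolyFun_s18.comp hp (d :: l) (by simp))
    simp only [polyVal_cons c (List.cons_ne_nil d l)]
    convert! this using 1
    simp only [List.length_cons, Nat.add_sub_cancel]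
    ring

end Polynomials

open ENNReal in
/-- If the group `eXe` carries a left-invariant probability measure for which some polynomial level
set is not null, then `X` is polyfinite. -/
theorem polyfinite_of_measure_ne_zero {X G : Type*} [Semigroup X] [Group G] [MeasurableSpace G]
    (μ : Measure G) [IsProbabilityMeasure μ] [MeasurableMul G] [μ.IsMulLeftInvariant]
    (i : G →ₙ* X) (hi : ∀ x, ∃ g : G, i 1 * x * i 1 = i g) (a : List (WithOne X)) (b : X)
    (ha : 2 ≤ a.length)
    (hmeas : MeasurableSet {g | polyVal a (i g) = b}) (hμ : μ {g | polyVal a (i g) = b} ≠ 0) :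
    Polyfinite X := by
  set A := {g | polyVal a (i g) = b} with hA
  obtain ⟨N, hN⟩ := ENNReal.exists_nat_mul_gt hμ one_ne_top
  have key : ∀ z : G, ∃ k, 1 ≤ k ∧ k ≤ N ∧ ∃ t, t ∈ A ∧ z ^ k * t ∈ A := by
    intro z
    have hne : ∃ m < N, ∃ n < N, m < n ∧ ¬ Disjoint ((z ^ m * ·) ⁻¹' A) ((z ^ n * ·) ⁻¹' A) := by
      by_contra! hd
      have hdis : (Finset.range N : Set ℕ).PairwiseDisjoint fun m => (z ^ m * ·) ⁻¹' A := by
        intro m hm n hn hmn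
        rcases lt_or_gt_of_ne hmn with h | h
        · exact hd m (by simpa using hm) n (by simpa using hn) h
        · exact (hd n (by simpa using hn) m (by simpa using hm) h).symm
      have h1 := measure_biUnion_finset (μ := μ) hdis
        fun m _ => (measurable_const_mul (z ^ m)) hmeas
      simp only [measure_preimage_mul, Finset.sum_const, Finset.card_range, nsmul_eq_mul] at h1
      exact absurd (h1 ▸ prob_le_one) hN.not_ge
    obtain ⟨m, hm, n, hn, hmn, hd⟩ := hne
    obtain ⟨t, ht1, ht2⟩ := Set.not_disjoint_iff.1 hd
    refine ⟨n - m, by omega, by omega, z ^ m * t, ht1, ?_⟩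
    rw [← mul_assoc, ← pow_add, Nat.sub_add_cancel hmn.le]
    exact ht2
  refine ⟨N * (a.length - 1), {b}, Set.finite_singleton b, fun x y => ?_⟩
  obtain ⟨g, hg⟩ := hi x
  obtain ⟨h, hh⟩ := hi y
  obtain ⟨k, hk1, hkN, t, ht, hzt⟩ := key (h * g⁻¹)
  choose γ hγ using hi
  have hpow : ∀ (w : G) (n : ℕ), ((i w : X) : WithOne X) ^ n * (i 1 : X) =
      ((i (w ^ n) : X) : WithOne X) := by
    intro w n
    induction n with
    | zero => simp
    | succ n ih => rw [pow_succ', mul_assoc, ih, pow_succ', map_mul, WithOne.coe_mul]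
  let p : X → X := fun w => i ((γ w * g⁻¹) ^ k * t)
  have hp : IsPolyFun_s18 k fun w => (p w : WithOne X) := by
    have h1 : IsPolyFun_s18 (1 * k) fun w : X =>
        ((i 1 : X) * (w : WithOne X) * (i 1 : X) * (i g⁻¹ : X)) ^ k :=
      ((((IsPolyFun_s18.const _).mul IsPolyFun_s18.id).mul (IsPolyFun_s18.const _)).mul
        (IsPolyFun_s18.const _)).pow k
    have h2 := (h1.mul (IsPolyFun_s18.const ((i 1 : X) : WithOne X))).mul
      (IsPolyFun_s18.const ((i t : X) : WithOne X))
    convert! h2 using 1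
    · omega
    · funext w
      rw [← WithOne.coe_mul, ← WithOne.coe_mul, hγ, ← WithOne.coe_mul, ← map_mul, hpow,
        ← WithOne.coe_mul, ← map_mul]
  obtain ⟨c, hc, hcx⟩ := hp.comp a (List.ne_nil_of_length_pos (by omega))
  have hx : p x = i t := by
    have : i ((γ x * g⁻¹) ^ k * t) = i t := by
      have hpow' := hpow (γ x * g⁻¹) k
      have h1 : i (γ x * g⁻¹) = i 1 := by
        rw [map_mul, ← hγ, hg, ← map_mul, mul_inv_cancel]
      rw [h1, hpow, one_pow] at hpow'
      rw [map_mul, ← WithOne.coe_inj.1 hpow', ← map_mul, one_mul]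
    exact this
  have hy : p y = i ((h * g⁻¹) ^ k * t) := by
    have : i ((γ y * g⁻¹) ^ k * t) = i ((h * g⁻¹) ^ k * t) := by
      have hpow' := hpow (γ y * g⁻¹) k
      have h1 : i (γ y * g⁻¹) = i (h * g⁻¹) := by
        rw [map_mul, ← hγ, hh, ← map_mul]
      rw [h1, hpow] at hpow'
      rw [map_mul, ← WithOne.coe_inj.1 hpow', ← map_mul]
    exact this
  have hdeg : 1 ≤ k * (a.length - 1) := Nat.mul_pos hk1 (by omega)
  have hdeg' : k * (a.length - 1) ≤ N * (a.length - 1) := Nat.mul_le_mul_right _ hkN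
  refine ⟨c, by omega, by omega, ⟨b, rfl, ?_⟩, b, rfl, ?_⟩
  · refine (hcx x).trans ?_
    change polyVal a (p x) = _
    rw [hx]
    exact ht
  · refine (hcx y).trans ?_
    change polyVal a (p y) = _
    rw [hy]
    exact hzt

/-- A descending family of nonempty sets generating a Hausdorff `0`-discrete semigroup topology on
`WithZero X` contradicts closedness of `X` in such topological semigroups. -/
theorem false_of_zero_filter {X I : Type u} [Semigroup X] [LinearOrder I] [Nonempty I]
    (hDiscr : ∀ (Y : Type u) [Semigroup Y] [TopologicalSpace Y],
      ∀ [ContinuousMul Y] [T2Space Y], ∀ z : Y,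
      ¬ IsOpen ({z} : Set Y) → (∀ y : Y, y ≠ z → IsOpen ({y} : Set Y)) →
      (∀ y : Y, z * y = z ∧ y * z = z) →
      ∀ f : X →ₙ* Y, Function.Injective f → IsClosed (Set.range f))
    (U : I → Set X) (hanti : Antitone U) (hne : ∀ α, (U α).Nonempty)
    (hmul : ∀ α, ∀ x ∈ U α, ∀ y ∈ U α, x * y ∈ U α)
    (hleft : ∀ α a, ∃ β, ∀ x ∈ U β, a * x ∈ U α) (hright : ∀ α a, ∃ β, ∀ x ∈ U β, x * a ∈ U α)
    (hsep : ∀ x, ∃ α, x ∉ U α) : False := by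
  let τ : TopologicalSpace (WithZero X) :=
    { IsOpen := fun s => 0 ∈ s → ∃ α, ∀ x ∈ U α, (x : WithZero X) ∈ s
      isOpen_univ := fun _ => ⟨Classical.arbitrary I, fun _ _ => trivial⟩
      isOpen_inter := by
        rintro s t hs ht ⟨h0s, h0t⟩
        obtain ⟨α, hα⟩ := hs h0s
        obtain ⟨β, hβ⟩ := ht h0t
        exact ⟨max α β, fun x hx => ⟨hα x (hanti (le_max_left _ _) hx),
          hβ x (hanti (le_max_right _ _) hx)⟩⟩
      isOpen_sUnion := by
        rintro S hS ⟨s, hs, h0⟩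
        obtain ⟨α, hα⟩ := hS s hs h0
        exact ⟨α, fun x hx => ⟨s, hs, hα x hx⟩⟩ }
  have hopen : ∀ s : Set (WithZero X),
      IsOpen s ↔ (0 ∈ s → ∃ α, ∀ x ∈ U α, (x : WithZero X) ∈ s) := fun s => Iff.rfl
  have hsing : ∀ y : WithZero X, y ≠ 0 → IsOpen ({y} : Set (WithZero X)) := fun y hy =>
    (hopen _).2 fun h => absurd h.symm hy
  have hV : ∀ α, IsOpen (insert 0 ((↑) '' U α) : Set (WithZero X)) := fun α =>
    (hopen _).2 fun _ => ⟨α, fun x hx => Or.inr ⟨x, hx, rfl⟩⟩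
  have hdis : ∀ y : WithZero X, y ≠ 0 → ∃ u v : Set (WithZero X),
      IsOpen u ∧ IsOpen v ∧ y ∈ u ∧ 0 ∈ v ∧ Disjoint u v := by
    intro y hy
    obtain ⟨x, rfl⟩ := WithZero.ne_zero_iff_exists.1 hy
    obtain ⟨α, hα⟩ := hsep x
    refine ⟨_, _, hsing _ hy, hV α, rfl, Set.mem_insert _ _, ?_⟩
    rw [Set.disjoint_singleton_left]
    rintro (h | ⟨x', hx', h⟩)
    · exact hy h
    · exact hα (WithZero.coe_injective h ▸ hx')
  have hT2 : T2Space (WithZero X) := ⟨fun p q hpq => by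
    rcases eq_or_ne p 0 with rfl | hp
    · obtain ⟨u, v, hu, hv, h1, h2, h⟩ := hdis q hpq.symm
      exact ⟨v, u, hv, hu, h2, h1, h.symm⟩
    · rcases eq_or_ne q 0 with rfl | hq
      · exact hdis p hp
      · exact ⟨{p}, {q}, hsing p hp, hsing q hq, rfl, rfl, by simpa using hpq⟩⟩
  have hcont : ContinuousMul (WithZero X) := ⟨continuous_def.2 fun W hW => by
    refine isOpen_prod_iff.2 fun p q hpq => ?_
    change p * q ∈ W at hpq
    induction p using WithZero.recZeroCoe with
    | zero =>
      rw [zero_mul] at hpq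
      obtain ⟨α, hα⟩ := hW hpq
      induction q using WithZero.recZeroCoe with
      | zero =>
        refine ⟨_, _, hV α, hV α, Set.mem_insert _ _, Set.mem_insert _ _, ?_⟩
        rintro ⟨_, _⟩ ⟨rfl | ⟨x, hx, rfl⟩, rfl | ⟨y, hy, rfl⟩⟩
        · simpa using hpq
        · simpa using hpq
        · simpa using hpq
        · exact hα _ (hmul α x hx y hy)
      | coe b =>
        obtain ⟨β, hβ⟩ := hright α b
        refine ⟨_, _, hV β, hsing b WithZero.coe_ne_zero, Set.mem_insert _ _, rfl, ?_⟩
        rintro ⟨_, _⟩ ⟨rfl | ⟨x, hx, rfl⟩, rfl⟩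
        · simpa using hpq
        · exact hα _ (hβ x hx)
    | coe a =>
      induction q using WithZero.recZeroCoe with
      | zero =>
        rw [mul_zero] at hpq
        obtain ⟨α, hα⟩ := hW hpq
        obtain ⟨β, hβ⟩ := hleft α a
        refine ⟨_, _, hsing a WithZero.coe_ne_zero, hV β, rfl, Set.mem_insert _ _, ?_⟩
        rintro ⟨_, _⟩ ⟨rfl, rfl | ⟨x, hx, rfl⟩⟩
        · simpa using hpq
        · exact hα _ (hβ x hx)
      | coe b =>
        refine ⟨_, _, hsing a WithZero.coe_ne_zero, hsing b WithZero.coe_ne_zero, rfl, rfl, ?_⟩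
        rintro ⟨_, _⟩ ⟨rfl, rfl⟩
        exact hpq⟩
  have hcl := hDiscr (WithZero X) 0 (fun h => by
      obtain ⟨α, hα⟩ := h rfl
      obtain ⟨x, hx⟩ := hne α
      exact WithZero.coe_ne_zero (hα x hx)) hsing (fun y => ⟨zero_mul y, mul_zero y⟩)
    ⟨(↑), fun _ _ => rfl⟩ WithZero.coe_injective
  obtain ⟨α, hα⟩ := (hopen _).1 hcl.isOpen_compl (by
    rintro ⟨x, hx⟩
    exact WithZero.coe_ne_zero hx)
  obtain ⟨x, hx⟩ := hne α
  exact hα x hx ⟨x, rfl⟩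

theorem mk_closure_lt_continuum_s18 {M : Type u} [Monoid M] {s : Set M}
    (hs : Cardinal.mk s < Cardinal.continuum) :
    Cardinal.mk (Submonoid.closure s) < Cardinal.continuum := by
  have hsurj : Function.Surjective fun l : List s => (⟨(l.map (↑)).prod,
      Submonoid.list_prod_mem _ (by
        intro x hx
        obtain ⟨y, -, rfl⟩ := List.mem_map.1 hx
        exact Submonoid.subset_closure y.2)⟩ : Submonoid.closure s) := by
    rintro ⟨x, hx⟩
    obtain ⟨l, hl, rfl⟩ := Submonoid.exists_list_of_mem_closure hx
    refine ⟨l.attach.map fun y => ⟨y.1, hl _ y.2⟩, ?_⟩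
    simp [Function.comp_def]
  exact (Cardinal.mk_le_of_surjective hsurj).trans_lt ((Cardinal.mk_list_le_max s).trans_lt
    (max_lt Cardinal.aleph0_lt_continuum hs))

/-- If a quotient of `X` of size at most continuum cannot be covered by fewer than continuum many
polynomial level sets, then `X` is not closed in some Hausdorff `0`-discrete semigroup topology. -/
theorem false_of_avoiding {X T : Type u} [Semigroup X]
    (hDiscr : ∀ (Y : Type u) [Semigroup Y] [TopologicalSpace Y],
      ∀ [ContinuousMul Y] [T2Space Y], ∀ z : Y,
      ¬ IsOpen ({z} : Set Y) → (∀ y : Y, y ≠ z → IsOpen ({y} : Set Y)) →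
      (∀ y : Y, z * y = z ∧ y * z = z) →
      ∀ f : X →ₙ* Y, Function.Injective f → IsClosed (Set.range f))
    (Φ : WithOne X → T)
    (hΦ : ∀ x x' y y', Φ x = Φ x' → Φ y = Φ y' → Φ (x * y) = Φ (x' * y'))
    (hcard : Cardinal.mk (Set.range Φ) ≤ Cardinal.continuum)
    (havoid : ∀ (ι : Type u) (a : ι → List (WithOne X)) (b : ι → WithOne X),
      Cardinal.mk ι < Cardinal.continuum → (∀ i, 2 ≤ (a i).length) →
      ∃ x, ∀ i, Φ (polyVal (a i) x) ≠ Φ (b i)) : False := by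
  let I : Type u := (Cardinal.continuum.{u}).ord.ToType
  have hI : Cardinal.mk I = Cardinal.continuum.{u} := Cardinal.mk_ord_toType _
  have : NoMaxOrder I := Cardinal.noMaxOrder Cardinal.aleph0_le_continuum
  have : Nonempty I := Cardinal.mk_ne_zero_iff.1 (hI ▸ Cardinal.continuum_ne_zero)
  obtain ⟨s, hs⟩ : ∃ s : I → WithOne X, ∀ m, ∃ α, Φ m = Φ (s α) := by
    obtain ⟨e⟩ : Nonempty (Set.range Φ ↪ I) := by rwa [← Cardinal.le_def, hI]
    have : Nonempty (Set.range Φ) := ⟨⟨_, 1, rfl⟩⟩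
    refine ⟨fun α => (Function.invFun e α).2.choose, fun m => ⟨e ⟨_, m, rfl⟩, ?_⟩⟩
    rw [(Function.invFun e _).2.choose_spec, Function.leftInverse_invFun e.injective]
  let gen : ∀ α : I, (∀ β, β < α → X) → Set (WithOne X) := fun α xs =>
    Set.range (Sum.elim (fun β : Set.Iio α => s β) fun β : Set.Iio α => (xs β β.2 : WithOne X))
  have hstep : ∀ α xs, ∃ x : X, ∀ (a : List (WithOne X)) (b : WithOne X), 2 ≤ a.length →
      (∀ c ∈ a, c ∈ Submonoid.closure (gen α xs)) → b ∈ Submonoid.closure (gen α xs) →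
      Φ (polyVal a x) ≠ Φ b := by
    intro α xs
    have hlt : Cardinal.mk (Set.Iio α) < Cardinal.continuum := by
      simpa only [hI] using Cardinal.mk_Iio_lt α (by rw [hI, Ordinal.type_toType])
    have hgen : Cardinal.mk (gen α xs) < Cardinal.continuum := by
      refine Cardinal.mk_range_le.trans_lt ?_
      rw [Cardinal.mk_sum, Cardinal.lift_id]
      exact Cardinal.add_lt_of_lt Cardinal.aleph0_le_continuum hlt hlt
    have hN := mk_closure_lt_continuum_s18 hgen
    set N := Submonoid.closure (gen α xs)
    obtain ⟨x, hx⟩ := havoid ({a : List N // 2 ≤ a.length} × N) (fun p => p.1.1.map (↑))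
      (fun p => p.2) (by
        rw [Cardinal.mk_prod, Cardinal.lift_id, Cardinal.lift_id]
        refine Cardinal.mul_lt_of_lt Cardinal.aleph0_le_continuum ?_ hN
        exact (Cardinal.mk_subtype_le _).trans_lt ((Cardinal.mk_list_le_max N).trans_lt
          (max_lt Cardinal.aleph0_lt_continuum hN))) (fun p => by simpa using p.1.2)
    refine ⟨x, fun a b ha haN hb => ?_⟩
    have := hx ⟨⟨a.attach.map fun c => ⟨c.1, haN _ c.2⟩, by simpa using ha⟩, ⟨b, hb⟩⟩
    simpa [Function.comp_def] using this
  choose step hstep using hstep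
  let x : I → X := (wellFounded_lt (α := I)).fix step
  have hx : ∀ α, x α = step α fun β _ => x β := fun α => WellFounded.fix_eq _ _ _
  let N : I → Submonoid (WithOne X) := fun α => Submonoid.closure (gen α fun β _ => x β)
  have hav : ∀ α (a : List (WithOne X)) (b : WithOne X), 2 ≤ a.length → (∀ c ∈ a, c ∈ N α) →
      b ∈ N α → Φ (polyVal a (x α)) ≠ Φ b := by
    intro α a b ha haN hb
    rw [hx]
    exact hstep α _ a b ha haN hb
  have hsN : ∀ {α β}, β < α → s β ∈ N α := fun {α β} h =>
    Submonoid.subset_closure ⟨Sum.inl ⟨β, h⟩, rfl⟩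
  have hxN : ∀ {α β}, β < α → (x β : WithOne X) ∈ N α := fun {α β} h =>
    Submonoid.subset_closure ⟨Sum.inr ⟨β, h⟩, rfl⟩
  have hNmono : Monotone N := by
    intro α β hαβ
    refine Submonoid.closure_le.2 ?_
    rintro _ ⟨γ | γ, rfl⟩
    · exact hsN (γ.2.trans_le hαβ)
    · exact hxN (γ.2.trans_le hαβ)
  let U : I → Set X := fun α => {y | ∃ k, α ≤ k ∧ ∃ a : List (WithOne X), 2 ≤ a.length ∧
    (∀ c ∈ a, c ∈ N k) ∧ Φ y = Φ (polyVal a (x k))}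
  have hconst_mul : ∀ k (c : WithOne X) (a : List (WithOne X)), c ∈ N k → 2 ≤ a.length →
      (∀ c ∈ a, c ∈ N k) → ∃ a' : List (WithOne X), 2 ≤ a'.length ∧ (∀ c ∈ a', c ∈ N k) ∧
        polyVal a' (x k) = c * polyVal a (x k) := by
    intro k c a hc ha haN
    obtain ⟨a', h1, h2, h3⟩ := exists_polyVal_eq_mul (N k)
      (List.ne_nil_of_length_pos (by omega)) haN [c] (by simp) (by simpa using hc)
    refine ⟨a', by simp at h1; omega, h2, ?_⟩
    rw [h3, polyVal_singleton]
  have hmul_const : ∀ k (c : WithOne X) (a : List (WithOne X)), c ∈ N k → 2 ≤ a.length →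
      (∀ c ∈ a, c ∈ N k) → ∃ a' : List (WithOne X), 2 ≤ a'.length ∧ (∀ c ∈ a', c ∈ N k) ∧
        polyVal a' (x k) = polyVal a (x k) * c := by
    intro k c a hc ha haN
    obtain ⟨a', h1, h2, h3⟩ := exists_polyVal_eq_mul (N k) (b := [c]) (by simp)
      (by simpa using hc) a (List.ne_nil_of_length_pos (by omega)) haN
    refine ⟨a', by simp at h1; omega, h2, ?_⟩
    rw [h3, polyVal_singleton]
  refine false_of_zero_filter hDiscr U ?_ ?_ ?_ ?_ ?_ ?_
  · rintro α β hαβ y ⟨k, hk, h⟩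
    exact ⟨k, hαβ.trans hk, h⟩
  · intro α
    refine ⟨x α, α, le_rfl, [1, 1], by simp, ?_, by simp [polyVal]⟩
    simp
  · rintro α y ⟨k, hk, a, ha, haN, hy⟩ z ⟨l, hl, b, hb, hbN, hz⟩
    rcases lt_trichotomy k l with h | rfl | h
    · obtain ⟨c, hc, hcN, hcv⟩ := hconst_mul l (polyVal a (x k)) b
        (polyVal_mem _ (hxN h) a fun c hc => hNmono h.le (haN c hc)) hb hbN
      refine ⟨l, hl, c, hc, hcN, ?_⟩
      rw [WithOne.coe_mul, hcv]
      exact hΦ _ _ _ _ hy hz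
    · obtain ⟨c, hc, hcN, hcv⟩ := exists_polyVal_eq_mul (N k)
        (List.ne_nil_of_length_pos (by omega)) hbN a (List.ne_nil_of_length_pos (by omega)) haN
      refine ⟨k, hk, c, by omega, hcN, ?_⟩
      rw [WithOne.coe_mul, hcv]
      exact hΦ _ _ _ _ hy hz
    · obtain ⟨c, hc, hcN, hcv⟩ := hmul_const k (polyVal b (x l)) a
        (polyVal_mem _ (hxN h) b fun c hc => hNmono h.le (hbN c hc)) ha haN
      refine ⟨k, hk, c, hc, hcN, ?_⟩
      rw [WithOne.coe_mul, hcv]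
      exact hΦ _ _ _ _ hy hz
  · intro α m
    obtain ⟨β, hβ⟩ := hs m
    obtain ⟨γ, hγ⟩ := exists_gt (max α β)
    refine ⟨γ, ?_⟩
    rintro y ⟨k, hk, a, ha, haN, hy⟩
    have hβk : β < k := ((le_max_right _ _).trans_lt hγ).trans_le hk
    obtain ⟨c, hc, hcN, hcv⟩ := hconst_mul k (s β) a (hsN hβk) ha haN
    refine ⟨k, ((le_max_left _ _).trans hγ.le).trans hk, c, hc, hcN, ?_⟩
    rw [WithOne.coe_mul, hcv]
    exact hΦ _ _ _ _ hβ hy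
  · intro α m
    obtain ⟨β, hβ⟩ := hs m
    obtain ⟨γ, hγ⟩ := exists_gt (max α β)
    refine ⟨γ, ?_⟩
    rintro y ⟨k, hk, a, ha, haN, hy⟩
    have hβk : β < k := ((le_max_right _ _).trans_lt hγ).trans_le hk
    obtain ⟨c, hc, hcN, hcv⟩ := hmul_const k (s β) a (hsN hβk) ha haN
    refine ⟨k, ((le_max_left _ _).trans hγ.le).trans hk, c, hc, hcN, ?_⟩
    rw [WithOne.coe_mul, hcv]
    exact hΦ _ _ _ _ hy hβ
  · intro y
    obtain ⟨β, hβ⟩ := hs y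
    obtain ⟨γ, hγ⟩ := exists_gt β
    refine ⟨γ, ?_⟩
    rintro ⟨k, hk, a, ha, haN, hy⟩
    exact hav k a (s β) ha haN (hsN (hγ.trans_le hk)) (hy.symm.trans hβ)

theorem polyVal_ne_one {X : Type*} [Semigroup X] {a : List (WithOne X)} (ha : 2 ≤ a.length)
    (x : X) : polyVal a x ≠ 1 := by
  have hmul : ∀ c d : WithOne X, c * x * d ≠ 1 := by
    intro c d
    induction c using WithOne.recOneCoe <;> induction d using WithOne.recOneCoe <;>
      simp [← WithOne.coe_mul]
  match a, ha with
  | c :: d :: l, _ =>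
    rw [polyVal_cons c (by simp)]
    exact hmul _ _

theorem map_polyVal_eq {X T : Type*} [Semigroup X] {Φ : WithOne X → T}
    (hΦ : ∀ x x' y y', Φ x = Φ x' → Φ y = Φ y' → Φ (x * y) = Φ (x' * y')) {x y : X}
    (hxy : Φ x = Φ y) : ∀ a : List (WithOne X), Φ (polyVal a x) = Φ (polyVal a y)
  | [] => rfl
  | [c] => by rw [polyVal_singleton, polyVal_singleton]
  | c :: d :: l => by
    rw [polyVal_cons c (by simp), polyVal_cons c (by simp)]
    exact hΦ _ _ _ _ (hΦ _ _ _ _ rfl hxy) (map_polyVal_eq hΦ hxy (d :: l))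

theorem mk_le_continuum_of_compact_metrizable (Z : Type*) [TopologicalSpace Z] [CompactSpace Z]
    [TopologicalSpace.MetrizableSpace Z] : Cardinal.mk Z ≤ Cardinal.continuum := by
  borelize Z
  let := TopologicalSpace.metrizableSpaceMetric Z
  have : PolishSpace Z := inferInstance
  have h := Cardinal.mk_le_of_injective (f := fun z => ULift.up (embeddingReal Z z)) fun x y h =>
    (measurableEmbedding_embeddingReal Z).injective (ULift.up_injective h)
  simpa [Cardinal.mk_real] using h

/-- A compact Hausdorff topological semigroup that is closed in Hausdorff `0`-discrete topological
semigroups is polyfinite, provided `cov(N̄) = 𝔠`. -/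
theorem polyfinite_of_compactSpace {X : Type u} [Semigroup X] [TopologicalSpace X]
    [CompactSpace X] [T2Space X] [ContinuousMul X] [Nonempty X]
    (hcov : covClosedNull = Cardinal.continuum)
    (hDiscr : ∀ (Y : Type u) [Semigroup Y] [TopologicalSpace Y],
      ∀ [ContinuousMul Y] [T2Space Y], ∀ z : Y,
      ¬ IsOpen ({z} : Set Y) → (∀ y : Y, y ≠ z → IsOpen ({y} : Set Y)) →
      (∀ y : Y, z * y = z ∧ y * z = z) →
      ∀ f : X →ₙ* Y, Function.Injective f → IsClosed (Set.range f)) :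
    Polyfinite X := by
  obtain ⟨G, _, _, _, _, _, i, hi, hsurj⟩ := exists_compact_group X
  borelize G
  let μ : Measure G := Measure.haarMeasure ⊤
  have : IsProbabilityMeasure μ := ⟨by
    simpa using Measure.haarMeasure_self (K₀ := (⊤ : TopologicalSpace.PositiveCompacts G))⟩
  have hcont : ∀ a : List (WithOne X), 2 ≤ a.length → Continuous fun g => polyVal a (i g) := by
    intro a ha
    obtain ⟨n, hn⟩ := Nat.exists_eq_add_of_le' (Nat.one_le_of_lt ha)
    obtain ⟨v, rfl⟩ : ∃ v : Fin (n + 1) → WithOne X, a = List.ofFn v :=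
      ⟨fun k => a.get (k.cast hn.symm), by rw [← List.ofFn_congr hn, List.ofFn_get]⟩
    exact (continuous_polyVal n).comp (continuous_const.prodMk hi)
  by_cases hnull : ∀ (a : List (WithOne X)) (b : X), 2 ≤ a.length →
      μ {g | polyVal a (i g) = b} = 0
  swap
  · push Not at hnull
    obtain ⟨a, b, ha, hab⟩ := hnull
    exact polyfinite_of_measure_ne_zero μ i hsurj a b ha
      (isClosed_eq (hcont a ha) continuous_const).measurableSet hab
  obtain ⟨T, _, _, Φ, hΦc, hΦ, hΦnull⟩ := exists_metrizable_congruence μ hi fun a b ha => by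
    induction b using WithOne.recOneCoe with
    | one => simp [polyVal_ne_one ha]
    | coe b => exact hnull a b ha
  have hcompact : CompactSpace (Set.range Φ) := isCompact_iff_compactSpace.1 (isCompact_range hΦc)
  refine (false_of_avoiding hDiscr Φ hΦ (mk_le_continuum_of_compact_metrizable _) ?_).elim
  intro ι a b hι ha
  let φ : G → T := fun g => Φ (i g)
  have hφ : Continuous φ := hΦc.comp (isOpenEmbedding_coe_withOne.continuous.comp hi)
  let q : G → Set.range φ := Set.rangeFactorization φ
  have hq : Continuous q := hφ.subtype_mk _
  have : CompactSpace (Set.range φ) := isCompact_iff_compactSpace.1 (isCompact_range hφ)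
  let : MeasurableSpace (Set.range φ) := borel _
  have : BorelSpace (Set.range φ) := ⟨rfl⟩
  let ν : Measure (Set.range φ) := μ.map q
  have : IsProbabilityMeasure ν := Measure.isProbabilityMeasure_map hq.aemeasurable
  have : NullSingletonClass ν := ⟨by
    rintro ⟨_, g, rfl⟩
    rw [Measure.map_apply hq.measurable (measurableSet_singleton _)]
    convert! hΦnull [1, 1] (i g) (by simp) using 2
    ext h
    simp [q, φ, polyVal, Set.rangeFactorization, Subtype.ext_iff]⟩
  let L : ι → Set G := fun k => {g | Φ (polyVal (a k) (i g)) = Φ (b k)}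
  have hL : ∀ k, IsClosed (q '' L k) := fun k =>
    ((isClosed_eq (hΦc.comp (hcont (a k) (ha k))) continuous_const).isCompact.image hq).isClosed
  obtain ⟨⟨_, g, rfl⟩, hg⟩ := exists_forall_notMem_of_lt_covClosedNull ν hcov
    (fun k => q '' L k) hL (fun k => by
      rw [Measure.map_apply hq.measurable (hL k).measurableSet]
      refine measure_mono_null ?_ (hΦnull (a k) (b k) (ha k))
      rintro g ⟨h, hh, hgh⟩
      exact (map_polyVal_eq hΦ (congrArg Subtype.val hgh).symm (a k)).trans hh) hι
  exact ⟨i g, fun k hk => hg k ⟨g, hk, rfl⟩⟩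

end

/-- Under `cov(N̄) = 𝔠`, a subsemigroup `X` of a compact Hausdorff
topological semigroup is polyfinite provided the image of `X` is closed under every
injective homomorphism into a compact Hausdorff topological semigroup or a Hausdorff
0-discrete topological semigroup. -/
theorem statement18 {X : Type u} [Semigroup X]
    (K : Type u) [Semigroup K] [TopologicalSpace K] [CompactSpace K] [T2Space K]
    [ContinuousMul K] (emb : X →ₙ* K) (hemb : Function.Injective emb)
    (hcov : covClosedNull = Cardinal.continuum)
    (hCompact : ∀ (Y : Type u) [Semigroup Y] [TopologicalSpace Y],
      ∀ [ContinuousMul Y] [CompactSpace Y] [T2Space Y],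
      ∀ f : X →ₙ* Y, Function.Injective f → IsClosed (Set.range f))
    (hDiscr : ∀ (Y : Type u) [Semigroup Y] [TopologicalSpace Y],
      ∀ [ContinuousMul Y] [T2Space Y], ∀ z : Y,
      ¬ IsOpen ({z} : Set Y) → (∀ y : Y, y ≠ z → IsOpen ({y} : Set Y)) →
      (∀ y : Y, z * y = z ∧ y * z = z) →
      ∀ f : X →ₙ* Y, Function.Injective f → IsClosed (Set.range f)) :
    Polyfinite X := by
  rcases isEmpty_or_nonempty X with hX | hX
  · exact ⟨0, ∅, Set.finite_empty, fun x => hX.elim x⟩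
  let : TopologicalSpace X := .induced emb inferInstance
  have hind : Topology.IsInducing emb := ⟨rfl⟩
  have hclosed : Topology.IsClosedEmbedding emb := ⟨⟨hind, hemb⟩, hCompact K emb hemb⟩
  have : CompactSpace X := hclosed.compactSpace
  have : T2Space X := hclosed.isEmbedding.t2Space
  have : ContinuousMul X := hind.continuousMul emb
  exact polyfinite_of_compactSpace hcov hDiscr

end ZeroClosedPaper
end
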